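/- arXiv:2412.13971 — 2 statements merged into one kernel-verified Lean document; each statement's English description precedes it below -/
import Mathlib

section
/- For all integers n ≥ 3 and 1 ≤ m ≤ n − 2, there exist a connected gentle algebra A of rank n (over any algebraically closed field k) and a pre-tilting A-module M with exactly m pairwise non-isomorphic indecomposable direct summands such that M is not partial-tilting, i.e. there is no module N for which M ⊕ N is a tilting module. -/
open CategoryTheory

universe u

/-- The combinatorial data of a gentle presentation: a finite quiver together with a
set of relations given by composable paths of length two, satisfying the gentle
conditions. -/
structure GentleQuiverData : Type (u + 1) where
  /-- vertices -/
  V : Type u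
  /-- arrows -/
  E : Type u
  fintV : Fintype V
  fintE : Fintype E
  /-- source -/
  src : E → V
  /-- target -/
  tgt : E → V
  /-- `rel a b` means that the length-two path `ab` is one of the generating relations -/
  rel : E → E → Prop
  rel_comp : ∀ a b, rel a b → tgt a = src b
  src_le_two : ∀ v : V, Set.ncard {a : E | src a = v} ≤ 2
  tgt_le_two : ∀ v : V, Set.ncard {a : E | tgt a = v} ≤ 2
  rel_right_unique : ∀ a b c, rel a b → rel a c → b = c
  rel_left_unique : ∀ a b c, rel b a → rel c a → b = c
  nonrel_right_unique : ∀ a b c, tgt a = src b → ¬ rel a b → tgt a = src c → ¬ rel a c → b = c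
  nonrel_left_unique : ∀ a b c, tgt b = src a → ¬ rel b a → tgt c = src a → ¬ rel c a → b = c

attribute [instance] GentleQuiverData.fintV GentleQuiverData.fintE

/-- The quiver is connected. -/
def GentleQuiverData.Connected (Q : GentleQuiverData.{u}) : Prop :=
  ∀ v w : Q.V, Relation.ReflTransGen
    (fun x y => ∃ a : Q.E, (Q.src a = x ∧ Q.tgt a = y) ∨ (Q.src a = y ∧ Q.tgt a = x)) v w

variable (k : Type u) [Field k]

/-- The relations presenting the gentle algebra `kQ/I` as a quotient of the free algebra
on vertices and arrows: the vertices are orthogonal idempotents summing to `1`, arrows are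
compatible with sources and targets, and the chosen length-two paths vanish. -/
inductive GentleRel (Q : GentleQuiverData.{u}) :
    FreeAlgebra k (Q.V ⊕ Q.E) → FreeAlgebra k (Q.V ⊕ Q.E) → Prop
  | idem (v : Q.V) :
      GentleRel Q (FreeAlgebra.ι k (Sum.inl v) * FreeAlgebra.ι k (Sum.inl v))
        (FreeAlgebra.ι k (Sum.inl v))
  | orth (v w : Q.V) : v ≠ w →
      GentleRel Q (FreeAlgebra.ι k (Sum.inl v) * FreeAlgebra.ι k (Sum.inl w)) 0
  | sum_idem :
      GentleRel Q (∑ v : Q.V, FreeAlgebra.ι k (Sum.inl v)) 1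
  | src_mul (a : Q.E) :
      GentleRel Q (FreeAlgebra.ι k (Sum.inl (Q.src a)) * FreeAlgebra.ι k (Sum.inr a))
        (FreeAlgebra.ι k (Sum.inr a))
  | mul_tgt (a : Q.E) :
      GentleRel Q (FreeAlgebra.ι k (Sum.inr a) * FreeAlgebra.ι k (Sum.inl (Q.tgt a)))
        (FreeAlgebra.ι k (Sum.inr a))
  | relation (a b : Q.E) : Q.rel a b →
      GentleRel Q (FreeAlgebra.ι k (Sum.inr a) * FreeAlgebra.ι k (Sum.inr b)) 0

/-- The gentle algebra `kQ/I` associated to gentle quiver data. -/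
abbrev GentleAlg (Q : GentleQuiverData.{u}) : Type u := RingQuot (GentleRel k Q)

section Modules

variable {B : Type u} [Ring B]

/-- `X` belongs to `add T`: it is a direct summand of a finite direct sum of copies of `T`. -/
def MemAdd (T X : ModuleCat.{u} B) : Prop :=
  ∃ (n : ℕ) (f : X →ₗ[B] (Fin n → T)) (g : (Fin n → T) →ₗ[B] X), g.comp f = LinearMap.id

/-- An indecomposable module: nonzero, and any direct sum decomposition is trivial. -/
def IsIndec (X : ModuleCat.{u} B) : Prop :=
  Nontrivial X ∧ ∀ Y Z : ModuleCat.{u} B,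
    Nonempty (X ≃ₗ[B] Y × Z) → Subsingleton Y ∨ Subsingleton Z

/-- `M` decomposes as the direct sum of the family `N` of pairwise non-isomorphic
indecomposable modules; in particular `M` is multiplicity-free. -/
def IsIndecDecomp (M : ModuleCat.{u} B) {m : ℕ} (N : Fin m → ModuleCat.{u} B) : Prop :=
  (∀ i, IsIndec (N i)) ∧
  (∀ i j, i ≠ j → IsEmpty (N i ≃ₗ[B] N j)) ∧
  Nonempty (M ≃ₗ[B] ((i : Fin m) → N i))

/-- `M` is multiplicity-free with exactly `m` pairwise non-isomorphic indecomposable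
direct summands. -/
def HasRank (M : ModuleCat.{u} B) (m : ℕ) : Prop :=
  ∃ N : Fin m → ModuleCat.{u} B, IsIndecDecomp M N

/-- Projective dimension at most `d`held via an explicit projective resolution. -/
def ProjDimLE : ModuleCat.{u} B → ℕ → Prop
  | X, 0 => Module.Projective B X
  | X, (d + 1) => ∃ P : ModuleCat.{u} B, Module.Projective B P ∧
      ∃ f : P →ₗ[B] X, Function.Surjective f ∧ ProjDimLE (ModuleCat.of B (LinearMap.ker f)) d

/-- (T1): finite projective dimension. -/
def HasFiniteProjDim (X : ModuleCat.{u} B) : Prop := ∃ d, ProjDimLE X d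

/-- There is an exact sequence `0 → X → T₀ → ⋯ → T_d → 0` with all `Tᵢ` in `add T`. -/
def CoresolvedBy (T : ModuleCat.{u} B) : ModuleCat.{u} B → ℕ → Prop
  | X, 0 => MemAdd T X
  | X, (d + 1) => ∃ T₀ : ModuleCat.{u} B, MemAdd T T₀ ∧
      ∃ f : X →ₗ[B] T₀, Function.Injective f ∧
        CoresolvedBy T (ModuleCat.of B (T₀ ⧸ LinearMap.range f)) d

/-- The Ext-group `Ext^n_B(X, Y)`. -/
noncomputable def ExtGroup (X Y : ModuleCat.{u} B) (n : ℕ) : Type (u + 1) :=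
  letI : HasDerivedCategory.{u + 1} (ModuleCat.{u} B) := HasDerivedCategory.standard _
  letI : HasExt.{u + 1} (ModuleCat.{u} B) := hasExt_of_hasDerivedCategory _
  Abelian.Ext X Y n

/-- (T2): `Ext^i(T, T) = 0` for all `i > 0`. -/
def SelfOrthogonal (T : ModuleCat.{u} B) : Prop :=
  ∀ i : ℕ, 0 < i → Subsingleton (ExtGroup T T i)

/-- Pre-tilting: (T1) and (T2). -/
def IsPreTilting (T : ModuleCat.{u} B) : Prop :=
  HasFiniteProjDim T ∧ SelfOrthogonal T

/-- Tilting: (T1), (T2) and (T3) (an `add T`-coresolution of the regular module). -/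
def IsTilting (T : ModuleCat.{u} B) : Prop :=
  HasFiniteProjDim T ∧ SelfOrthogonal T ∧ ∃ d, CoresolvedBy T (ModuleCat.of B B) d

/-- The direct sum `M ⊕ N`. -/
def dSum (M N : ModuleCat.{u} B) : ModuleCat.{u} B := ModuleCat.of B (M × N)

/-- `N` is an (indecomposable) complement to `M`: a finite-dimensional indecomposable module
not in `add M` such that `M ⊕ N` is a tilting module. -/
def IsComplement (M N : ModuleCat.{u} B) : Prop :=
  Module.Finite B N ∧ IsIndec N ∧ ¬ MemAdd M N ∧ IsTilting (dSum M N)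

end Modules

section ExtLemmas

variable {B : Type u} [Ring B]

/-- A short exact sequence of modules, from linear maps. -/
theorem shortExact_ofHom {X Y Z : ModuleCat.{u} B} (f : X →ₗ[B] Y) (g : Y →ₗ[B] Z)
    (hf : Function.Injective f) (hfg : Function.Exact f g) (hg : Function.Surjective g) :
    (ShortComplex.mk (ModuleCat.ofHom f) (ModuleCat.ofHom g) (by
      ext x; exact hfg.apply_apply_eq_zero x)).ShortExact := by
  refine @ShortComplex.ShortExact.mk' _ _ _ _ ?_ ?_ ?_
  · exact (ShortComplex.ShortExact.moduleCat_exact_iff_function_exact _).mpr hfg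
  · exact (ModuleCat.mono_iff_injective _).mpr hf
  · exact (ModuleCat.epi_iff_surjective _).mpr hg

theorem ExtGroup.subsingleton_of_retract {T X Y : ModuleCat.{u} B} {n : ℕ}
    (hT : Subsingleton (ExtGroup T T n))
    (i : X →ₗ[B] T) (p : T →ₗ[B] X) (hpi : p ∘ₗ i = LinearMap.id)
    (j : Y →ₗ[B] T) (q : T →ₗ[B] Y) (hqj : q ∘ₗ j = LinearMap.id) :
    Subsingleton (ExtGroup X Y n) := by
  unfold ExtGroup at *
  let : HasDerivedCategory.{u + 1} (ModuleCat.{u} B) := HasDerivedCategory.standard _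
  let : HasExt.{u + 1} (ModuleCat.{u} B) := hasExt_of_hasDerivedCategory _
  refine subsingleton_of_forall_eq 0 fun (x : Abelian.Ext X Y n) ↦ ?_
  have hX : ModuleCat.ofHom i ≫ ModuleCat.ofHom p = 𝟙 X := by
    rw [← ModuleCat.ofHom_comp, hpi]; rfl
  have hY : ModuleCat.ofHom j ≫ ModuleCat.ofHom q = 𝟙 Y := by
    rw [← ModuleCat.ofHom_comp, hqj]; rfl
  have key : ((Abelian.Ext.mk₀ (ModuleCat.ofHom p)).comp x (zero_add n)).comp
      (Abelian.Ext.mk₀ (ModuleCat.ofHom j)) (add_zero n) = 0 := Subsingleton.elim _ _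
  have h2 := congrArg (fun t : Abelian.Ext T T n ↦
    ((Abelian.Ext.mk₀ (ModuleCat.ofHom i)).comp t (zero_add n)).comp
      (Abelian.Ext.mk₀ (ModuleCat.ofHom q)) (add_zero n)) key
  simpa [hX, hY, Abelian.Ext.mk₀_comp_mk₀_assoc] using h2

section

variable {K P X Y : ModuleCat.{u} B} {f : K →ₗ[B] P} {g : P →ₗ[B] X}
  (hf : Function.Injective f) (hfg : Function.Exact f g) (hg : Function.Surjective g)

include hf hfg hg

theorem exists_extension_of_ext_one (h : Subsingleton (ExtGroup X Y 1)) (a : K →ₗ[B] Y) :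
    ∃ b : P →ₗ[B] Y, b ∘ₗ f = a := by
  unfold ExtGroup at *
  let : HasDerivedCategory.{u + 1} (ModuleCat.{u} B) := HasDerivedCategory.standard _
  let : HasExt.{u + 1} (ModuleCat.{u} B) := hasExt_of_hasDerivedCategory _
  have hS := shortExact_ofHom f g hf hfg hg
  obtain ⟨x, hx⟩ := Abelian.Ext.contravariant_sequence_exact₁ hS Y
    (Abelian.Ext.mk₀ (ModuleCat.ofHom a)) (add_zero 1) (Subsingleton.elim _ _)
  obtain ⟨b, rfl⟩ := (Abelian.Ext.mk₀_bijective P Y).2 x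
  refine ⟨b.hom, ?_⟩
  rw [Abelian.Ext.mk₀_comp_mk₀] at hx
  have := (Abelian.Ext.mk₀_bijective K Y).1 hx
  exact congrArg ModuleCat.Hom.hom this

theorem ExtGroup.subsingleton_one_of_hom_eq_zero (hP : Module.Projective B P)
    (h : ∀ a : K →ₗ[B] Y, a = 0) : Subsingleton (ExtGroup X Y 1) := by
  unfold ExtGroup at *
  let : HasDerivedCategory.{u + 1} (ModuleCat.{u} B) := HasDerivedCategory.standard _
  let : HasExt.{u + 1} (ModuleCat.{u} B) := hasExt_of_hasDerivedCategory _
  have hS := shortExact_ofHom f g hf hfg hg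
  have : Projective P := (IsProjective.iff_projective _).mp hP
  refine subsingleton_of_forall_eq 0 fun (x : Abelian.Ext X Y 1) ↦ ?_
  obtain ⟨y, rfl⟩ := Abelian.Ext.contravariant_sequence_exact₃ hS Y x
    (Abelian.Ext.eq_zero_of_projective _) (add_zero 1)
  obtain ⟨b, rfl⟩ := (Abelian.Ext.mk₀_bijective K Y).2 y
  have hb : b = 0 := by ext1; exact h b.hom
  simp [hb]

theorem ExtGroup.subsingleton_succ_iff (hP : Module.Projective B P) (n : ℕ) :
    Subsingleton (ExtGroup X Y (n + 2)) ↔ Subsingleton (ExtGroup K Y (n + 1)) := by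
  unfold ExtGroup
  let : HasDerivedCategory.{u + 1} (ModuleCat.{u} B) := HasDerivedCategory.standard _
  let : HasExt.{u + 1} (ModuleCat.{u} B) := hasExt_of_hasDerivedCategory _
  have hS := shortExact_ofHom f g hf hfg hg
  have : Projective P := (IsProjective.iff_projective _).mp hP
  constructor <;> intro h
  · refine subsingleton_of_forall_eq 0 fun (x : Abelian.Ext K Y (n + 1)) ↦ ?_
    obtain ⟨y, rfl⟩ := Abelian.Ext.contravariant_sequence_exact₁ hS Y x (n₁ := n + 2) (by lia)
      (Subsingleton.elim _ _)
    rw [Abelian.Ext.eq_zero_of_projective y, Abelian.Ext.comp_zero]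
  · refine subsingleton_of_forall_eq 0 fun (x : Abelian.Ext X Y (n + 2)) ↦ ?_
    obtain ⟨y, rfl⟩ := Abelian.Ext.contravariant_sequence_exact₃ hS Y x
      (Abelian.Ext.eq_zero_of_projective _) (n₀ := n + 1) (by lia)
    rw [Subsingleton.elim y 0, Abelian.Ext.comp_zero]

end

theorem ExtGroup.subsingleton_of_projective {P Y : ModuleCat.{u} B} (hP : Module.Projective B P)
    (n : ℕ) : Subsingleton (ExtGroup P Y (n + 1)) := by
  unfold ExtGroup
  let : HasDerivedCategory.{u + 1} (ModuleCat.{u} B) := HasDerivedCategory.standard _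
  let : HasExt.{u + 1} (ModuleCat.{u} B) := hasExt_of_hasDerivedCategory _
  have : Projective P := (IsProjective.iff_projective _).mp hP
  exact Abelian.Ext.subsingleton_of_projective P Y n

/-- If `X` has an `add T`-coresolution, then an element acting as zero on `T` acts as zero on
`X`. -/
theorem CoresolvedBy.smul_eq_zero {T X : ModuleCat.{u} B} {d : ℕ} (h : CoresolvedBy T X d)
    {b : B} (hb : ∀ t : T, b • t = 0) (x : X) : b • x = 0 := by
  have memAdd {Y : ModuleCat.{u} B} (hY : MemAdd T Y) (y : Y) : b • y = 0 := by
    obtain ⟨n, f, g, hgf⟩ := hY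
    have : b • f y = 0 := by ext i; exact hb _
    have e : g (f (b • y)) = b • y := LinearMap.congr_fun hgf (b • y)
    rw [← e, map_smul, this, map_zero]
  cases d with
  | zero => exact memAdd h x
  | succ d =>
    obtain ⟨T₀, hT₀, f, hf, -⟩ := h
    exact hf (by rw [map_smul, memAdd hT₀, map_zero])

end ExtLemmas

/-- Elements of a ring satisfying the relations of the opposite of the gentle algebra of `Q`, so
that modules are covariant representations of the bound quiver. -/
structure PathSystem (Q : GentleQuiverData.{u}) (C : Type*) [Ring C] where
  /-- the idempotents -/
  vtx : Q.V → C
  /-- the arrows -/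
  arr : Q.E → C
  vtx_mul_self : ∀ v, vtx v * vtx v = vtx v
  vtx_mul_vtx : ∀ v w, v ≠ w → vtx v * vtx w = 0
  sum_vtx : ∑ v, vtx v = 1
  arr_mul_src : ∀ y, arr y * vtx (Q.src y) = arr y
  tgt_mul_arr : ∀ y, vtx (Q.tgt y) * arr y = arr y
  arr_mul_arr : ∀ x y, Q.rel x y → arr y * arr x = 0

namespace PathSystem

section

variable {k : Type u} [Field k] {Q : GentleQuiverData.{u}}

theorem arr_mul_vtx {C : Type*} [Ring C] (s : PathSystem Q C) {y : Q.E} {v : Q.V}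
    (h : Q.src y ≠ v) : s.arr y * s.vtx v = 0 := by
  rw [← s.arr_mul_src y, mul_assoc, s.vtx_mul_vtx _ _ h, mul_zero]

theorem vtx_mul_arr {C : Type*} [Ring C] (s : PathSystem Q C) {y : Q.E} {v : Q.V}
    (h : v ≠ Q.tgt y) : s.vtx v * s.arr y = 0 := by
  rw [← s.tgt_mul_arr y, ← mul_assoc, s.vtx_mul_vtx _ _ h, zero_mul]

variable (k) in
/-- The path system generates `B` and is universal among path systems of endomorphisms of vector
spaces. -/
structure IsUniversal {B : Type u} [Ring B] [Algebra k B] (s : PathSystem Q B) : Prop where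
  adjoin_eq_top : Algebra.adjoin k (Set.range s.vtx ∪ Set.range s.arr) = ⊤
  exists_lift : ∀ {X : Type u} [AddCommGroup X] [Module k X] (t : PathSystem Q (Module.End k X)),
    ∃ φ : B →ₐ[k] Module.End k X, (∀ v, φ (s.vtx v) = t.vtx v) ∧ ∀ y, φ (s.arr y) = t.arr y

variable (k Q) in
/-- The generators of the opposite of the gentle algebra. -/
noncomputable def gentle : PathSystem Q (GentleAlg k Q)ᵐᵒᵖ where
  vtx v := .op (RingQuot.mkAlgHom k (GentleRel k Q) (FreeAlgebra.ι k (Sum.inl v)))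
  arr y := .op (RingQuot.mkAlgHom k (GentleRel k Q) (FreeAlgebra.ι k (Sum.inr y)))
  vtx_mul_self v := by
    rw [← MulOpposite.op_mul, ← map_mul, RingQuot.mkAlgHom_rel k (GentleRel.idem v)]
  vtx_mul_vtx v w h := by
    rw [← MulOpposite.op_mul, ← map_mul, RingQuot.mkAlgHom_rel k (GentleRel.orth w v h.symm),
      map_zero, MulOpposite.op_zero]
  sum_vtx := by
    rw [← Finset.op_sum, ← map_sum, RingQuot.mkAlgHom_rel k (GentleRel.sum_idem (k := k) (Q := Q)),
      map_one, MulOpposite.op_one]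
  arr_mul_src y := by
    rw [← MulOpposite.op_mul, ← map_mul, RingQuot.mkAlgHom_rel k (GentleRel.src_mul y)]
  tgt_mul_arr y := by
    rw [← MulOpposite.op_mul, ← map_mul, RingQuot.mkAlgHom_rel k (GentleRel.mul_tgt y)]
  arr_mul_arr x y h := by
    rw [← MulOpposite.op_mul, ← map_mul, RingQuot.mkAlgHom_rel k (GentleRel.relation x y h),
      map_zero, MulOpposite.op_zero]

theorem isUniversal_gentle : (gentle k Q).IsUniversal k where
  adjoin_eq_top := by
    rw [eq_top_iff]
    rintro x -
    induction x using MulOpposite.rec' with | _ x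
    obtain ⟨x, rfl⟩ := RingQuot.mkAlgHom_surjective k (GentleRel k Q) x
    induction x using FreeAlgebra.induction with
    | grade0 c =>
      rw [AlgHom.commutes, ← MulOpposite.algebraMap_apply]
      exact Subalgebra.algebraMap_mem _ c
    | grade1 x =>
      refine Algebra.subset_adjoin ?_
      rcases x with v | y
      · exact .inl ⟨v, rfl⟩
      · exact .inr ⟨y, rfl⟩
    | mul x y hx hy =>
      rw [map_mul, MulOpposite.op_mul]
      exact mul_mem hy hx
    | add x y hx hy =>
      rw [map_add, MulOpposite.op_add]
      exact add_mem hx hy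
  exists_lift {X} _ _ t := by
    let F : FreeAlgebra k (Q.V ⊕ Q.E) →ₐ[k] (Module.End k X)ᵐᵒᵖ :=
      FreeAlgebra.lift k fun x ↦ .op (x.elim t.vtx t.arr)
    have hF ⦃x y⦄ (h : GentleRel k Q x y) : F x = F y := by
      apply MulOpposite.unop_injective
      cases h with
      | idem v => simp [F, t.vtx_mul_self]
      | orth v w h => simp [F, t.vtx_mul_vtx w v h.symm]
      | sum_idem => simp [F, t.sum_vtx]
      | src_mul y => simp [F, t.arr_mul_src]
      | mul_tgt y => simp [F, t.tgt_mul_arr]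
      | relation x y h => simp [F, t.arr_mul_arr x y h]
    refine ⟨AlgHom.opComm (RingQuot.liftAlgHom k ⟨F, hF⟩), fun v ↦ ?_, fun y ↦ ?_⟩ <;>
      simp [gentle, F]

end

variable {k : Type u} [Field k] {Q : GentleQuiverData.{u}} {B : Type u} [Ring B] [Algebra k B]
  {s : PathSystem Q B}

namespace IsUniversal

variable (hs : s.IsUniversal k)
include hs

/-- A path system of endomorphisms of a vector space defines a module. -/
theorem exists_moduleCat {X : Type u} [AddCommGroup X] [Module k X]
    (t : PathSystem Q (Module.End k X)) :
    ∃ (E : ModuleCat.{u} B) (ψ : E ≃+ X), (∀ (c : k) x, ψ (algebraMap k B c • x) = c • ψ x) ∧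
      (∀ v x, ψ (s.vtx v • x) = t.vtx v (ψ x)) ∧ ∀ y x, ψ (s.arr y • x) = t.arr y (ψ x) := by
  obtain ⟨φ, h1, h2⟩ := hs.exists_lift t
  let : Module B X := Module.compHom X φ.toRingHom
  refine ⟨ModuleCat.of B X, AddEquiv.refl X, fun c x ↦ ?_, fun v x ↦ ?_, fun y x ↦ ?_⟩
  · exact (LinearMap.congr_fun (φ.commutes c) x)
  · exact LinearMap.congr_fun (h1 v) x
  · exact LinearMap.congr_fun (h2 y) x

theorem map_smul_of_generators {X Y : Type*} [AddCommGroup X] [AddCommGroup Y] [Module B X]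
    [Module B Y] (f : X →+ Y)
    (hc : ∀ (c : k) x, f (algebraMap k B c • x) = algebraMap k B c • f x)
    (hv : ∀ v x, f (s.vtx v • x) = s.vtx v • f x) (hy : ∀ y x, f (s.arr y • x) = s.arr y • f x)
    (b : B) (x : X) : f (b • x) = b • f x := by
  have hb : b ∈ Algebra.adjoin k (Set.range s.vtx ∪ Set.range s.arr) := by
    rw [hs.adjoin_eq_top]; trivial
  induction hb using Algebra.adjoin_induction generalizing x with
  | mem b hb =>
    rcases hb with ⟨v, rfl⟩ | ⟨y, rfl⟩
    · exact hv v x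
    · exact hy y x
  | algebraMap c => exact hc c x
  | add a b _ _ ha hb => rw [add_smul, add_smul, map_add, ha, hb]
  | mul a b _ _ ha hb => rw [mul_smul, mul_smul, ha, hb]

/-- Modulo the left ideal of paths starting with an arrow out of `v`, each element of `B` acts on
the trivial path at `v` by a scalar. -/
theorem exists_scalar (b : B) (v : Q.V) : ∃ c : k,
    b * s.vtx v - c • s.vtx v ∈ Ideal.span (s.arr '' {y | Q.src y = v}) := by
  have hb : b ∈ Algebra.adjoin k (Set.range s.vtx ∪ Set.range s.arr) := by
    rw [hs.adjoin_eq_top]; trivial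
  induction hb using Algebra.adjoin_induction with
  | mem b hb =>
    rcases hb with ⟨w, rfl⟩ | ⟨y, rfl⟩
    · by_cases h : w = v
      · exact ⟨1, by simp [h, s.vtx_mul_self]⟩
      · exact ⟨0, by simp [s.vtx_mul_vtx w v h]⟩
    · refine ⟨0, ?_⟩
      by_cases h : Q.src y = v
      · subst h
        rw [zero_smul, sub_zero, s.arr_mul_src]
        exact Ideal.subset_span ⟨y, rfl, rfl⟩
      · simp [s.arr_mul_vtx h]
  | algebraMap c => exact ⟨c, by simp [Algebra.smul_def]⟩
  | add a b _ _ ha hb =>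
    obtain ⟨c, hc⟩ := ha
    obtain ⟨d, hd⟩ := hb
    exact ⟨c + d, by simpa [add_mul, add_smul, add_sub_add_comm] using add_mem hc hd⟩
  | mul a b _ _ ha hb =>
    obtain ⟨c, hc⟩ := ha
    obtain ⟨d, hd⟩ := hb
    refine ⟨d * c, ?_⟩
    have : a * b * s.vtx v - (d * c) • s.vtx v =
        a * (b * s.vtx v - d • s.vtx v) + algebraMap k B d * (a * s.vtx v - c • s.vtx v) := by
      simp only [← Algebra.smul_def, mul_sub, mul_smul, mul_assoc, mul_smul_comm,
        smul_comm d c]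
      abel
    rw [this]
    exact add_mem (Ideal.mul_mem_left _ _ hd) (Ideal.mul_mem_left _ _ hc)

end IsUniversal

/-- `S` is the simple module at the vertex `v`. -/
structure SimpleAt (k : Type u) [Field k] {B : Type u} [Ring B] [Algebra k B]
    (s : PathSystem Q B) (v : Q.V) (S : ModuleCat.{u} B) where
  /-- the underlying line -/
  toField : S ≃+ k
  map_algebraMap_smul : ∀ (c : k) (x : S), toField (algebraMap k B c • x) = c * toField x
  vtx_smul_self : ∀ x : S, s.vtx v • x = x
  vtx_smul : ∀ w, w ≠ v → ∀ x : S, s.vtx w • x = 0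
  arr_smul : ∀ y (x : S), s.arr y • x = 0

namespace IsUniversal

variable (hs : s.IsUniversal k)
include hs

theorem exists_simpleAt (v : Q.V) : ∃ S : ModuleCat.{u} B, Nonempty (SimpleAt k s v S) := by
  classical
  let t : PathSystem Q (Module.End k k) :=
    { vtx w := if w = v then 1 else 0
      arr _ := 0
      vtx_mul_self w := by split_ifs <;> simp
      vtx_mul_vtx w w' h := by split_ifs with h1 h2 <;> simp_all
      sum_vtx := by simp
      arr_mul_src := by simp
      tgt_mul_arr := by simp
      arr_mul_arr := by simp }
  obtain ⟨S, ψ, h1, h2, h3⟩ := hs.exists_moduleCat t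
  refine ⟨S, ⟨⟨ψ, h1, fun x ↦ ψ.injective ?_, fun w hw x ↦ ψ.injective ?_,
    fun y x ↦ ψ.injective ?_⟩⟩⟩
  · simp [h2, t]
  · simp [h2, t, hw]
  · simp [h3, t]

/-- If `Ext¹(N, S)` vanishes for the simple module `S` at the target of an arrow `y`, then a linear
form vanishing on the images of all arrows `x` with `xy = 0` vanishes on the kernel of `y`. -/
theorem apply_eq_zero_of_ext_one {N S : ModuleCat.{u} B} [Module k N] [IsScalarTower k B N]
    (y : Q.E) (hS : SimpleAt k s (Q.tgt y) S) (hNS : Subsingleton (ExtGroup N S 1))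
    (φ : N →ₗ[k] k) (hφ : ∀ x, Q.rel x y → ∀ n : N, φ (s.arr x • n) = 0) {n : N}
    (hn : s.vtx (Q.src y) • n = n) (hyn : s.arr y • n = 0) : φ n = 0 := by
  classical
  let L (b : B) : N →ₗ[k] N := Algebra.lsmul k k N b
  have hL (b : B) (x : N) : L b x = b • x := rfl
  let t : PathSystem Q (Module.End k (N × k)) :=
    { vtx v := (L (s.vtx v)).prodMap (if v = Q.tgt y then 1 else 0)
      arr z := (L (s.arr z) ∘ₗ LinearMap.fst k N k).prod
        (if z = y then φ ∘ₗ L (s.vtx (Q.src y)) ∘ₗ LinearMap.fst k N k else 0)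
      vtx_mul_self v := by
        refine LinearMap.ext fun x ↦ Prod.ext ?_ ?_
        · simp [hL, ← mul_smul, s.vtx_mul_self]
        · by_cases h : v = Q.tgt y <;> simp [h]
      vtx_mul_vtx v w h := by
        refine LinearMap.ext fun x ↦ Prod.ext ?_ ?_
        · simp [hL, ← mul_smul, s.vtx_mul_vtx v w h]
        · by_cases h1 : v = Q.tgt y <;> by_cases h2 : w = Q.tgt y <;> simp_all
      sum_vtx := by
        refine LinearMap.ext fun x ↦ Prod.ext ?_ ?_
        · simp [hL, LinearMap.sum_apply, Prod.fst_sum, ← Finset.sum_smul, s.sum_vtx]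
        · simp [LinearMap.sum_apply, Prod.snd_sum, apply_ite, ite_apply]
      arr_mul_src z := by
        refine LinearMap.ext fun x ↦ Prod.ext ?_ ?_
        · simp [hL, ← mul_smul, s.arr_mul_src]
        · by_cases h : z = y <;> simp [h, hL, ← mul_smul, s.vtx_mul_self]
      tgt_mul_arr z := by
        refine LinearMap.ext fun x ↦ Prod.ext ?_ ?_
        · simp [hL, ← mul_smul, s.tgt_mul_arr]
        · by_cases h : z = y <;> simp [h]
      arr_mul_arr x z h := by
        refine LinearMap.ext fun x ↦ Prod.ext ?_ ?_
        · simp [hL, ← mul_smul, s.arr_mul_arr _ _ h]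
        · by_cases h' : z = y
          · subst h'
            simp [hL, ← mul_smul, ← Q.rel_comp _ _ h, s.tgt_mul_arr, hφ _ h]
          · simp [h'] }
  obtain ⟨E, ψ, h1, h2, h3⟩ := hs.exists_moduleCat t
  let i : S →ₗ[B] E :=
    { toFun x := ψ.symm (0, hS.toField x)
      map_add' x x' := by simp [← map_add]
      map_smul' b x := by
        refine hs.map_smul_of_generators
          ((ψ.symm.toAddMonoidHom.comp (AddMonoidHom.inr N k)).comp hS.toField.toAddMonoidHom)
          (fun c x ↦ ?_) (fun v x ↦ ?_) (fun y x ↦ ?_) b x <;> apply ψ.injective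
        · simp [h1, hS.map_algebraMap_smul]
        · by_cases hv : v = Q.tgt y
          · subst hv
            simp [h2, t, hS.vtx_smul_self]
          · simp [h2, t, hv, hS.vtx_smul v hv]
        · refine Prod.ext ?_ ?_
          · simp [h3, t, hS.arr_smul]
          · simp [h3, t, hS.arr_smul, apply_ite, ite_apply] }
  let p : E →ₗ[B] N :=
    { toFun x := (ψ x).1
      map_add' x x' := by simp
      map_smul' b x := by
        refine hs.map_smul_of_generators ((AddMonoidHom.fst N k).comp ψ.toAddMonoidHom)
          (fun c x ↦ ?_) (fun v x ↦ ?_) (fun y x ↦ ?_) b x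
        · simp [h1]
        · simp [h2, t, hL]
        · simp [h3, t, hL] }
  have hi (x : S) : i x = ψ.symm (0, hS.toField x) := rfl
  have hp (x : E) : p x = (ψ x).1 := rfl
  have hi' : Function.Injective i := fun x x' h ↦ by
    simpa [hi] using h
  have hip : Function.Exact i p := by
    intro x
    rw [hp]
    constructor
    · intro hx
      exact ⟨hS.toField.symm (ψ x).2, by simp [hi, ← hx]⟩
    · rintro ⟨x, rfl⟩
      simp [hi]
  have hp' : Function.Surjective p := fun x ↦ ⟨ψ.symm (x, 0), by simp [hp]⟩
  obtain ⟨ρ, hρ⟩ := exists_extension_of_ext_one hi' hip hp' hNS LinearMap.id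
  have key : s.arr y • ψ.symm (n, 0) = i (hS.toField.symm (φ n)) := by
    apply ψ.injective
    simp [h3, t, hi, hL, hn, hyn]
  have := congr_arg ρ key
  rw [map_smul, hS.arr_smul, ← LinearMap.comp_apply, hρ] at this
  simpa using this.symm

theorem eq_zero_of_projective {P : ModuleCat.{u} B} [Module k P] [IsScalarTower k B P]
    (hP : Module.Projective B P) (y : Q.E) (hy : ∀ x, ¬ Q.rel x y) {n : P}
    (hn : s.vtx (Q.src y) • n = n) (hyn : s.arr y • n = 0) : n = 0 := by
  obtain ⟨S, ⟨hS⟩⟩ := hs.exists_simpleAt (Q.tgt y)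
  rw [← Module.forall_dual_apply_eq_zero_iff k]
  exact fun φ ↦ hs.apply_eq_zero_of_ext_one y hS (ExtGroup.subsingleton_of_projective hP 0) φ
    (fun x hx ↦ (hy x hx).elim) hn hyn

theorem exists_arr_smul_eq_of_ext_one {N S : ModuleCat.{u} B} [Module k N] [IsScalarTower k B N]
    (y z : Q.E) (hz : ∀ x, Q.rel x z → x = y) (hS : SimpleAt k s (Q.tgt z) S)
    (hNS : Subsingleton (ExtGroup N S 1)) {n : N}
    (hn : s.vtx (Q.src z) • n = n) (hzn : s.arr z • n = 0) : ∃ n' : N, s.arr y • n' = n := by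
  by_contra! h
  obtain ⟨φ, h1, h2⟩ := Submodule.exists_le_ker_of_notMem
    (p := LinearMap.range (Algebra.lsmul k k N (s.arr y))) (v := n) fun ⟨n', hn'⟩ ↦ h n' hn'
  refine h1 (hs.apply_eq_zero_of_ext_one z hS hNS φ (fun x hx n ↦ ?_) hn hzn)
  rw [hz x hx]
  exact h2 ⟨n, rfl⟩

/-- If `yz = 0` is the only relation involving `y` or `z` on that side and `Ext²(N, S)` vanishes for
the simple module `S` at the target of `z`, then `y` acts injectively. -/
theorem eq_zero_of_ext_two {N S : ModuleCat.{u} B} (y z : Q.E) (hyz : Q.rel y z)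
    (hz : ∀ x, Q.rel x z → x = y) (hy : ∀ x, ¬ Q.rel x y) (hS : SimpleAt k s (Q.tgt z) S)
    (hNS : Subsingleton (ExtGroup N S 2)) {n : N}
    (hn : s.vtx (Q.src y) • n = n) (hyn : s.arr y • n = 0) : n = 0 := by
  let F : ModuleCat.{u} B := ModuleCat.of B (N →₀ B)
  have hF : Module.Projective B F := inferInstanceAs (Module.Projective B (N →₀ B))
  let f : F →ₗ[B] N := Finsupp.linearCombination B id
  have hf : Function.Surjective f := Finsupp.linearCombination_id_surjective B N
  let K : ModuleCat.{u} B := ModuleCat.of B (LinearMap.ker f)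
  let i : K →ₗ[B] F := (LinearMap.ker f).subtype
  have hi : Function.Injective i := Subtype.val_injective
  have hif : Function.Exact i f := LinearMap.exact_subtype_ker_map f
  have hK := (ExtGroup.subsingleton_succ_iff (Y := S) hi hif hf hF 0).1 hNS
  let : Module k F := inferInstanceAs (Module k (N →₀ B))
  have : IsScalarTower k B F := inferInstanceAs (IsScalarTower k B (N →₀ B))
  have : IsScalarTower k B K := ⟨fun a b x ↦ Subtype.ext (smul_assoc a b (i x))⟩
  obtain ⟨p, rfl⟩ := hf n
  have h1 : f (s.arr y • p) = 0 := by rw [map_smul, hyn]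
  obtain ⟨q, hq⟩ := hs.exists_arr_smul_eq_of_ext_one y z hz hS hK
    (n := (⟨s.arr y • p, h1⟩ : LinearMap.ker f))
    (Subtype.ext (by
      change s.vtx _ • s.arr y • p = s.arr y • p
      rw [← Q.rel_comp _ _ hyz, ← mul_smul, s.tgt_mul_arr]))
    (Subtype.ext (by
      change s.arr z • s.arr y • p = 0
      rw [← mul_smul, s.arr_mul_arr _ _ hyz, zero_smul]))
  have h2 : s.arr y • i q = s.arr y • p := congr_arg i hq
  have h3 : s.vtx (Q.src y) • (p - i q) = 0 := by
    refine hs.eq_zero_of_projective hF y hy ?_ ?_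
    · rw [← mul_smul, s.vtx_mul_self]
    · rw [← mul_smul, s.arr_mul_src, smul_sub, h2, sub_self]
  have h4 := congr_arg f h3
  rwa [map_smul, map_sub, hif.apply_apply_eq_zero, sub_zero, hn, map_zero] at h4

end IsUniversal

end PathSystem

namespace GentleExample

/-- The vertices: a line `p r → ⋯ → p 0`, and two vertices forming a cycle with `p 0`. -/
inductive Vertex (r : ℕ) : Type u
  | p (i : Fin (r + 1))
  | y
  | z

/-- The arrows. -/
inductive Arrow (r : ℕ) : Type u
  | a
  | b
  | e
  | c
  | d (i : Fin r)

namespace Vertex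

/-- The vertices as a sum of finite types. -/
def equivSum (r : ℕ) : Fin (r + 1) ⊕ Bool ≃ Vertex.{u} r where
  toFun := Sum.elim p fun x ↦ cond x y z
  invFun | p i => .inl i | y => .inr true | z => .inr false
  left_inv := by rintro (i | _ | _) <;> rfl
  right_inv := by rintro (i | _ | _) <;> rfl

instance (r : ℕ) : Fintype (Vertex.{u} r) := .ofEquiv _ (equivSum r)

theorem card_eq (r : ℕ) : Fintype.card (Vertex.{u} r) = r + 3 := by
  simp [← Fintype.card_congr (equivSum.{u} r)]

end Vertex

namespace Arrow

/-- The arrows as a sum of finite types. -/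
def equivSum (r : ℕ) : Fin r ⊕ Bool × Bool ≃ Arrow.{u} r where
  toFun := Sum.elim d fun x ↦ cond x.1 (cond x.2 a b) (cond x.2 e c)
  invFun
    | d i => .inl i
    | a => .inr (true, true)
    | b => .inr (true, false)
    | e => .inr (false, true)
    | c => .inr (false, false)
  left_inv := by rintro (i | ⟨_ | _, _ | _⟩) <;> rfl
  right_inv := by rintro (i | _ | _) <;> rfl

instance (r : ℕ) : Fintype (Arrow.{u} r) := .ofEquiv _ (equivSum r)

variable {r : ℕ}

/-- The source of an arrow. -/
def src : Arrow.{u} r → Vertex.{u} r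
  | a => .p 0
  | b => .y
  | e => .y
  | c => .z
  | d i => .p i.succ

/-- The target of an arrow. -/
def tgt : Arrow.{u} r → Vertex.{u} r
  | a => .y
  | b => .z
  | e => .z
  | c => .p 0
  | d i => .p i.castSucc

/-- The zero relations: `ab`, `ec`, and all paths of length two starting on the line. -/
def rel : Arrow.{u} r → Arrow.{u} r → Prop
  | d i, x => tgt (d i) = src x
  | a, b => True
  | e, c => True
  | _, _ => False

theorem ncard_src_le (v : Vertex.{u} r) : Set.ncard {x : Arrow.{u} r | src x = v} ≤ 2 := by
  obtain ⟨x, y, h⟩ : ∃ x y, {x : Arrow.{u} r | src x = v} ⊆ {x, y} := by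
    rcases v with i | _ | _
    · induction i using Fin.cases with
      | zero => exact ⟨a, a, by rintro (_ | _ | _ | _ | _) <;> simp [src]⟩
      | succ i =>
        exact ⟨d i, d i, by
          rintro (_ | _ | _ | _ | _) <;> simp [src, (Fin.succ_ne_zero _).symm]⟩
    · exact ⟨b, e, by rintro (_ | _ | _ | _ | _) <;> simp [src]⟩
    · exact ⟨c, c, by rintro (_ | _ | _ | _ | _) <;> simp [src]⟩
  exact (Set.ncard_le_ncard h).trans ((Set.ncard_insert_le x {y}).trans (by simp))

theorem ncard_tgt_le (v : Vertex.{u} r) : Set.ncard {x : Arrow.{u} r | tgt x = v} ≤ 2 := by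
  obtain ⟨x, y, h⟩ : ∃ x y, {x : Arrow.{u} r | tgt x = v} ⊆ {x, y} := by
    rcases v with i | _ | _
    · induction i using Fin.lastCases with
      | last => exact ⟨c, c, by rintro (_ | _ | _ | _ | _) <;> simp [tgt, Fin.castSucc_ne_last]⟩
      | cast i => exact ⟨c, d i, by rintro (_ | _ | _ | _ | _) <;> simp [tgt]⟩
    · exact ⟨a, a, by rintro (_ | _ | _ | _ | _) <;> simp [tgt]⟩
    · exact ⟨b, e, by rintro (_ | _ | _ | _ | _) <;> simp [tgt]⟩
  exact (Set.ncard_le_ncard h).trans ((Set.ncard_insert_le x {y}).trans (by simp))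

end Arrow

/-- A cycle of length three with a doubled arrow and a tail of length `r`. -/
@[reducible] def quiver (r : ℕ) : GentleQuiverData.{u} where
  V := Vertex r
  E := Arrow r
  fintV := inferInstance
  fintE := inferInstance
  src := Arrow.src
  tgt := Arrow.tgt
  rel := Arrow.rel
  rel_comp x y h := by
    rcases x with _ | _ | _ | _ | i <;> rcases y with _ | _ | _ | _ | j <;>
      simp_all [Arrow.rel, Arrow.src, Arrow.tgt]
  src_le_two := Arrow.ncard_src_le
  tgt_le_two := Arrow.ncard_tgt_le
  rel_right_unique x y z := by
    rcases x with _ | _ | _ | _ | i <;> rcases y with _ | _ | _ | _ | j <;>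
      rcases z with _ | _ | _ | _ | l <;>
      simp [Arrow.rel, Arrow.src, Arrow.tgt] <;> grind
  rel_left_unique x y z := by
    rcases x with _ | _ | _ | _ | i <;> rcases y with _ | _ | _ | _ | j <;>
      rcases z with _ | _ | _ | _ | l <;>
      simp [Arrow.rel, Arrow.src, Arrow.tgt] <;>
      exact fun h h' ↦ Fin.castSucc_injective r (h.trans h'.symm)
  nonrel_right_unique x y z := by
    rcases x with _ | _ | _ | _ | i <;> rcases y with _ | _ | _ | _ | j <;>
      rcases z with _ | _ | _ | _ | l <;>
      simp_all [Arrow.rel, Arrow.src, Arrow.tgt, (Fin.succ_ne_zero _).symm]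
  nonrel_left_unique x y z := by
    rcases x with _ | _ | _ | _ | i <;> rcases y with _ | _ | _ | _ | j <;>
      rcases z with _ | _ | _ | _ | l <;>
      simp_all [Arrow.rel, Arrow.src, Arrow.tgt, (Fin.succ_ne_zero _).symm]

theorem connected_quiver (r : ℕ) : (quiver.{u} r).Connected := by
  let R (v w : (quiver.{u} r).V) : Prop := ∃ x : (quiver.{u} r).E,
    ((quiver r).src x = v ∧ (quiver r).tgt x = w) ∨ ((quiver r).src x = w ∧ (quiver r).tgt x = v)
  have : Std.Symm R := ⟨fun _ _ ⟨x, h⟩ ↦ ⟨x, h.symm⟩⟩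
  have key (v : Vertex.{u} r) : Relation.ReflTransGen R (.p 0) v := by
    rcases v with i | _ | _
    · induction i using Fin.induction with
      | zero => exact .refl
      | succ i ih => exact ih.tail ⟨.d i, .inr ⟨rfl, rfl⟩⟩
    · exact .single ⟨.a, .inl ⟨rfl, rfl⟩⟩
    · exact .single ⟨.c, .inr ⟨rfl, rfl⟩⟩
  exact fun v w ↦ (symm (key v)).trans (key w)

open PathSystem

variable {k : Type u} [Field k] {r : ℕ} {B : Type u} [Ring B] [Algebra k B]
  {s : PathSystem (quiver.{u} r) B}

section Mul

variable (s)

theorem arr_b_mul_arr_a : s.arr .b * s.arr .a = 0 := s.arr_mul_arr _ _ trivial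

theorem arr_c_mul_arr_e : s.arr .c * s.arr .e = 0 := s.arr_mul_arr _ _ trivial

theorem vtx_y_mul_arr_a : s.vtx .y * s.arr .a = s.arr .a := s.tgt_mul_arr .a

theorem vtx_z_mul_arr_b : s.vtx .z * s.arr .b = s.arr .b := s.tgt_mul_arr .b

theorem vtx_z_mul_arr_e : s.vtx .z * s.arr .e = s.arr .e := s.tgt_mul_arr .e

theorem vtx_p_mul_arr_c : s.vtx (.p 0) * s.arr .c = s.arr .c := s.tgt_mul_arr .c

theorem vtx_p_mul_arr_d (i : Fin r) : s.vtx (.p i.castSucc) * s.arr (.d i) = s.arr (.d i) :=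
  s.tgt_mul_arr (.d i)

end Mul

section Basis

variable (hs : s.IsUniversal k)
include hs

theorem mul_vtx_p_zero (x : B) : ∃ (c : k) (x' : B),
    x * s.vtx (.p 0) = c • s.vtx (.p 0) + x' * s.arr .a := by
  obtain ⟨c, hc⟩ := hs.exists_scalar x (.p 0)
  have : s.arr '' {y | (quiver r).src y = .p 0} ⊆ {s.arr .a} := by
    rintro _ ⟨_ | _ | _ | _ | i, h, rfl⟩ <;> simp_all [Arrow.src]
  obtain ⟨x', hx'⟩ := Ideal.mem_span_singleton'.1 (Ideal.span_mono this hc)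
  exact ⟨c, x', by rw [hx']; abel⟩

theorem mul_vtx_p_succ (i : Fin r) (x : B) : ∃ (c : k) (x' : B),
    x * s.vtx (.p i.succ) = c • s.vtx (.p i.succ) + x' * s.arr (.d i) := by
  obtain ⟨c, hc⟩ := hs.exists_scalar x (.p i.succ)
  have : s.arr '' {y | (quiver r).src y = .p i.succ} ⊆ {s.arr (.d i)} := by
    rintro _ ⟨_ | _ | _ | _ | j, h, rfl⟩ <;> simp_all [Arrow.src, (Fin.succ_ne_zero _).symm]
  obtain ⟨x', hx'⟩ := Ideal.mem_span_singleton'.1 (Ideal.span_mono this hc)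
  exact ⟨c, x', by rw [hx']; abel⟩

theorem mul_vtx_z (x : B) : ∃ (c : k) (x' : B),
    x * s.vtx .z = c • s.vtx .z + x' * s.arr .c := by
  obtain ⟨c, hc⟩ := hs.exists_scalar x .z
  have : s.arr '' {y | (quiver r).src y = .z} ⊆ {s.arr .c} := by
    rintro _ ⟨_ | _ | _ | _ | i, h, rfl⟩ <;> simp_all [Arrow.src]
  obtain ⟨x', hx'⟩ := Ideal.mem_span_singleton'.1 (Ideal.span_mono this hc)
  exact ⟨c, x', by rw [hx']; abel⟩

theorem mul_vtx_y (x : B) : ∃ (c : k) (x' x'' : B),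
    x * s.vtx .y = c • s.vtx .y + x' * s.arr .b + x'' * s.arr .e := by
  obtain ⟨c, hc⟩ := hs.exists_scalar x .y
  have : s.arr '' {y | (quiver r).src y = .y} ⊆ {s.arr .b, s.arr .e} := by
    rintro _ ⟨_ | _ | _ | _ | i, h, rfl⟩ <;> simp_all [Arrow.src]
  obtain ⟨x', x'', hx'⟩ := Ideal.mem_span_pair.1 (Ideal.span_mono this hc)
  exact ⟨c, x', x'', by rw [add_assoc, hx']; abel⟩

theorem mul_arr_e (x : B) : ∃ c : k, x * s.arr .e = c • s.arr .e := by
  obtain ⟨c, x', h⟩ := mul_vtx_z hs x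
  refine ⟨c, ?_⟩
  rw [← vtx_z_mul_arr_e, ← mul_assoc, h, add_mul, mul_assoc, arr_c_mul_arr_e, mul_zero, add_zero,
    smul_mul_assoc]

theorem mul_arr_a (x : B) : ∃ c c' : k,
    x * s.arr .a = c • s.arr .a + c' • (s.arr .e * s.arr .a) := by
  obtain ⟨c, x', x'', h⟩ := mul_vtx_y hs x
  obtain ⟨c', h'⟩ := mul_arr_e hs x''
  refine ⟨c, c', ?_⟩
  rw [← vtx_y_mul_arr_a, ← mul_assoc, h, h', add_mul, add_mul, mul_assoc x', arr_b_mul_arr_a,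
    mul_zero, add_zero, smul_mul_assoc, smul_mul_assoc, vtx_y_mul_arr_a]

theorem mul_arr_c (x : B) : ∃ c c' c'' : k, x * s.arr .c =
    c • s.arr .c + c' • (s.arr .a * s.arr .c) + c'' • (s.arr .e * s.arr .a * s.arr .c) := by
  obtain ⟨c, x', h⟩ := mul_vtx_p_zero hs x
  obtain ⟨c', c'', h'⟩ := mul_arr_a hs x'
  refine ⟨c, c', c'', ?_⟩
  rw [← vtx_p_mul_arr_c, ← mul_assoc, h, h', add_mul, add_mul, smul_mul_assoc, smul_mul_assoc,
    smul_mul_assoc, vtx_p_mul_arr_c, add_assoc]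

theorem mul_arr_b (x : B) : ∃ c c' c'' c''' : k, x * s.arr .b = c • s.arr .b +
    (c' • (s.arr .c * s.arr .b) + c'' • (s.arr .a * s.arr .c * s.arr .b) +
      c''' • (s.arr .e * s.arr .a * s.arr .c * s.arr .b)) := by
  obtain ⟨c, x', h⟩ := mul_vtx_z hs x
  obtain ⟨c', c'', c''', h'⟩ := mul_arr_c hs x'
  refine ⟨c, c', c'', c''', ?_⟩
  rw [← vtx_z_mul_arr_b, ← mul_assoc, h, h', add_mul, add_mul, add_mul]
  simp only [smul_mul_assoc, mul_assoc, vtx_z_mul_arr_b]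

theorem mul_arr_d (i : Fin r) (x : B) : ∃ c : k, x * s.arr (.d i) = c • s.arr (.d i) := by
  suffices ∃ (c : k) (x' : B) (z : (quiver r).E), x * s.vtx (.p i.castSucc) =
      c • s.vtx (.p i.castSucc) + x' * s.arr z ∧ s.arr z * s.arr (.d i) = 0 by
    obtain ⟨c, x', z, h, hz⟩ := this
    refine ⟨c, ?_⟩
    rw [← vtx_p_mul_arr_d, ← mul_assoc, h, add_mul, mul_assoc, hz, mul_zero, add_zero,
      smul_mul_assoc]
  rcases r with _ | r
  · exact i.elim0
  · induction i using Fin.cases with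
    | zero =>
      obtain ⟨c, x', h⟩ := mul_vtx_p_zero hs x
      exact ⟨c, x', .a, h, s.arr_mul_arr _ _ rfl⟩
    | succ i =>
      obtain ⟨c, x', h⟩ := mul_vtx_p_succ hs i.castSucc x
      exact ⟨c, x', .d i.castSucc, h, s.arr_mul_arr _ _ rfl⟩

theorem finiteDimensional : FiniteDimensional k B := by
  let W : Set B := Set.range s.vtx ∪ Set.range s.arr ∪ {s.arr .e * s.arr .a,
    s.arr .a * s.arr .c, s.arr .e * s.arr .a * s.arr .c, s.arr .c * s.arr .b,
    s.arr .a * s.arr .c * s.arr .b, s.arr .e * s.arr .a * s.arr .c * s.arr .b}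
  have hW : W.Finite := ((Set.finite_range _).union (Set.finite_range _)).union (Set.toFinite _)
  refine ⟨Submodule.fg_def.2 ⟨W, hW, eq_top_iff.2 fun x _ ↦ ?_⟩⟩
  have hv (v) : s.vtx v ∈ Submodule.span k W := Submodule.subset_span (.inl (.inl ⟨v, rfl⟩))
  have ha (y) : s.arr y ∈ Submodule.span k W := Submodule.subset_span (.inl (.inr ⟨y, rfl⟩))
  have harr (y) (x : B) : x * s.arr y ∈ Submodule.span k W := by
    rcases y with _ | _ | _ | _ | i
    · obtain ⟨c, c', h⟩ := mul_arr_a hs x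
      rw [h]
      refine add_mem (Submodule.smul_mem _ _ (ha _)) (Submodule.smul_mem _ _ ?_)
      exact Submodule.subset_span (.inr (by simp))
    · obtain ⟨c, c', c'', c''', h⟩ := mul_arr_b hs x
      rw [h]
      refine add_mem (Submodule.smul_mem _ _ (ha _)) (add_mem (add_mem (Submodule.smul_mem _ _ ?_)
        (Submodule.smul_mem _ _ ?_)) (Submodule.smul_mem _ _ ?_)) <;>
        exact Submodule.subset_span (.inr (by simp))
    · obtain ⟨c, h⟩ := mul_arr_e hs x
      rw [h]
      exact Submodule.smul_mem _ _ (ha _)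
    · obtain ⟨c, c', c'', h⟩ := mul_arr_c hs x
      rw [h]
      refine add_mem (add_mem (Submodule.smul_mem _ _ (ha _)) (Submodule.smul_mem _ _ ?_))
        (Submodule.smul_mem _ _ ?_) <;>
        exact Submodule.subset_span (.inr (by simp))
    · obtain ⟨c, h⟩ := mul_arr_d hs i x
      rw [h]
      exact Submodule.smul_mem _ _ (ha _)
  rw [← mul_one x, ← s.sum_vtx, Finset.mul_sum]
  refine sum_mem fun v _ ↦ ?_
  rcases v with i | _ | _
  · induction i using Fin.cases with
    | zero =>
      obtain ⟨c, x', h⟩ := mul_vtx_p_zero hs x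
      rw [h]
      exact add_mem (Submodule.smul_mem _ _ (hv _)) (harr _ _)
    | succ i =>
      obtain ⟨c, x', h⟩ := mul_vtx_p_succ hs i x
      rw [h]
      exact add_mem (Submodule.smul_mem _ _ (hv _)) (harr _ _)
  · obtain ⟨c, x', x'', h⟩ := mul_vtx_y hs x
    rw [h]
    exact add_mem (add_mem (Submodule.smul_mem _ _ (hv _)) (harr _ _)) (harr _ _)
  · obtain ⟨c, x', h⟩ := mul_vtx_z hs x
    rw [h]
    exact add_mem (Submodule.smul_mem _ _ (hv _)) (harr _ _)

end Basis

section Uniserial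

/-- The vertices along the path `b c a e`. -/
def pathVertex (r : ℕ) : Fin 5 → Vertex.{u} r := ![.y, .z, .p 0, .y, .z]

open Classical in
variable (k) in
/-- The projection of `k⁵` onto the part at the vertex `v`. -/
noncomputable def pathVtx (v : Vertex.{u} r) : Module.End k (Fin 5 → k) :=
  LinearMap.pi fun i ↦ if pathVertex r i = v then LinearMap.proj i else 0

variable (k) in
/-- The matrix unit mapping the basis vector `i` to the basis vector `j`. -/
def matrixUnit (i j : Fin 5) : Module.End k (Fin 5 → k) :=
  LinearMap.single k (fun _ ↦ k) j ∘ₗ LinearMap.proj i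

theorem matrixUnit_single (i j : Fin 5) :
    matrixUnit k i j (Pi.single i 1) = Pi.single j 1 := by
  simp [matrixUnit]

theorem matrixUnit_mul_of_ne {i j i' j' : Fin 5} (h : j' ≠ i) :
    matrixUnit k i j * matrixUnit k i' j' = 0 := by
  ext; simp [matrixUnit, h.symm]

theorem matrixUnit_mul_pathVtx (i j : Fin 5) :
    matrixUnit k i j * pathVtx k (pathVertex.{u} r i) = matrixUnit k i j := by
  refine LinearMap.ext fun f ↦ ?_
  simp [matrixUnit, pathVtx]

theorem pathVtx_mul_matrixUnit (i j : Fin 5) :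
    pathVtx k (pathVertex.{u} r j) * matrixUnit k i j = matrixUnit k i j := by
  refine LinearMap.ext fun f ↦ funext fun l ↦ ?_
  rcases eq_or_ne l j with rfl | h
  · simp [matrixUnit, pathVtx]
  · by_cases h' : pathVertex.{u} r l = pathVertex r j <;> simp [matrixUnit, pathVtx, h, h']

variable (k r) in
/-- The uniserial representation along the path `b c a e`. -/
noncomputable def uniserial : PathSystem (quiver.{u} r) (Module.End k (Fin 5 → k)) where
  vtx := pathVtx k
  arr
    | .a => matrixUnit k 2 3
    | .b => matrixUnit k 0 1
    | .e => matrixUnit k 3 4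
    | .c => matrixUnit k 1 2
    | .d _ => 0
  vtx_mul_self v := by
    refine LinearMap.ext fun f ↦ funext fun l ↦ ?_
    by_cases h : pathVertex r l = v <;> simp [pathVtx, h]
  vtx_mul_vtx v w hvw := by
    refine LinearMap.ext fun f ↦ funext fun l ↦ ?_
    by_cases h : pathVertex r l = v
    · simp [pathVtx, h, hvw]
    · simp [pathVtx, h]
  sum_vtx := by
    refine LinearMap.ext fun f ↦ funext fun l ↦ ?_
    rw [LinearMap.sum_apply, Finset.sum_apply]
    classical
    refine (Finset.sum_congr rfl fun v _ ↦ ?_).trans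
      (Fintype.sum_ite_eq (pathVertex r l) fun _ ↦ f l)
    by_cases h : pathVertex r l = v <;> simp [pathVtx, h]
  arr_mul_src x := by
    rcases x with _ | _ | _ | _ | i
    · exact matrixUnit_mul_pathVtx 2 3
    · exact matrixUnit_mul_pathVtx 0 1
    · exact matrixUnit_mul_pathVtx 3 4
    · exact matrixUnit_mul_pathVtx 1 2
    · exact zero_mul _
  tgt_mul_arr x := by
    rcases x with _ | _ | _ | _ | i
    · exact pathVtx_mul_matrixUnit 2 3
    · exact pathVtx_mul_matrixUnit 0 1
    · exact pathVtx_mul_matrixUnit 3 4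
    · exact pathVtx_mul_matrixUnit 1 2
    · exact mul_zero _
  arr_mul_arr x y h := by
    rcases x with _ | _ | _ | _ | i <;> rcases y with _ | _ | _ | _ | j <;>
      first
      | exact h.elim
      | exact mul_zero _
      | exact matrixUnit_mul_of_ne (by decide)

end Uniserial

variable (hs : s.IsUniversal k)
include hs

theorem exists_uniserial : ∃ (U : ModuleCat.{u} B) (_ : Module k U) (_ : IsScalarTower k B U)
    (u : Fin 5 → U), LinearIndependent k u ∧ s.arr .b • u 0 = u 1 ∧ s.arr .c • u 1 = u 2 ∧
      s.arr .a • u 2 = u 3 ∧ s.arr .e • u 3 = u 4 := by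
  obtain ⟨U, ψ, h1, -, h3⟩ := hs.exists_moduleCat (uniserial k r)
  let : Module k U := Module.compHom U (algebraMap k B)
  have hU (c : k) (x : U) : c • x = algebraMap k B c • x := rfl
  have h1' (c : k) (x : U) : ψ (c • x) = c • ψ x := h1 c x
  have : IsScalarTower k B U := ⟨fun c b x ↦ by rw [Algebra.smul_def, mul_smul, hU]⟩
  refine ⟨U, inferInstance, this, fun i ↦ ψ.symm (Pi.single i 1), ?_, ?_, ?_, ?_, ?_⟩
  · refine Fintype.linearIndependent_iff.2 fun g hg i ↦ ?_
    have := congr_fun (congr_arg ψ hg) i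
    simpa [h1', Finset.sum_apply, Pi.single_apply] using this
  all_goals
    apply ψ.injective
    rw [h3, ψ.apply_symm_apply, ψ.apply_symm_apply]
    exact matrixUnit_single _ _

/-- The annihilator of `a` in the projective module at `y` is generated by `b`. -/
theorem exists_mul_arr_b {x : B} (hx : x * s.vtx .y = x) (hxa : x * s.arr .a = 0) :
    ∃ x' : B, x' * s.arr .b = x := by
  obtain ⟨c, x', x'', h⟩ := mul_vtx_y hs x
  obtain ⟨c', h'⟩ := mul_arr_e hs x''
  rw [hx, h'] at h
  obtain ⟨U, _, _, u, hu, -, -, h2, h3⟩ := exists_uniserial hs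
  have h4 : c • u 3 + c' • u 4 = 0 := by
    have h5 : x • u 3 = 0 := by rw [← h2, ← mul_smul, hxa, zero_smul]
    have h6 : s.vtx .y • u 3 = u 3 := by rw [← h2, ← mul_smul, vtx_y_mul_arr_a]
    have h7 : s.arr .b • u 3 = 0 := by rw [← h2, ← mul_smul, arr_b_mul_arr_a, zero_smul]
    rw [← h5, h, add_smul, add_smul, mul_smul, h7, smul_zero, add_zero, smul_assoc, smul_assoc, h6,
      h3]
  have h5 := Fintype.linearIndependent_iff.1 hu ![0, 0, 0, c, c'] (by simpa [Fin.sum_univ_five])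
  have h6 : c = 0 := h5 3
  have h7 : c' = 0 := h5 4
  exact ⟨x', by simp [h, h6, h7]⟩

/-- Right multiplication by `b` is injective on the projective module at `z`. -/
theorem eq_zero_of_mul_arr_b {x : B} (hx : x * s.vtx .z = x) (hxb : x * s.arr .b = 0) : x = 0 := by
  obtain ⟨c, x', h⟩ := mul_vtx_z hs x
  obtain ⟨c', c'', c''', h'⟩ := mul_arr_c hs x'
  rw [hx, h'] at h
  obtain ⟨U, _, _, u, hu, h0, h1, h2, h3⟩ := exists_uniserial hs
  have h4 : c • u 1 + (c' • u 2 + c'' • u 3 + c''' • u 4) = 0 := by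
    have h5 : x • u 1 = 0 := by rw [← h0, ← mul_smul, hxb, zero_smul]
    have h6 : s.vtx .z • u 1 = u 1 := by rw [← h0, ← mul_smul, vtx_z_mul_arr_b]
    simp only [← h5, h, add_smul, smul_assoc, mul_smul, h1, h2, h3, h6]
  have h5 := Fintype.linearIndependent_iff.1 hu ![0, c, c', c'', c''']
    (by simpa [Fin.sum_univ_five, add_assoc] using h4)
  have e1 : c = 0 := h5 1
  have e2 : c' = 0 := h5 2
  have e3 : c'' = 0 := h5 3
  have e4 : c''' = 0 := h5 4
  simp [h, e1, e2, e3, e4]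

theorem arr_a_ne_zero : s.arr .a ≠ 0 := by
  obtain ⟨U, _, _, u, hu, -, -, h, -⟩ := exists_uniserial hs
  intro h0
  exact hu.ne_zero 3 (by rw [← h, h0, zero_smul])

end GentleExample

section Resolution

variable {B : Type u} [Ring B] {P₂ P₁ P₀ X : ModuleCat.{u} B} {g₂ : P₂ →ₗ[B] P₁}
  {g₁ : P₁ →ₗ[B] P₀} {f : P₀ →ₗ[B] X}

theorem exact_codRestrict_ker (h₁ : Function.Exact g₁ f) (h₂ : Function.Exact g₂ g₁) :
    Function.Exact g₂
      (g₁.codRestrict (LinearMap.ker f) fun x ↦ h₁.apply_apply_eq_zero x) := fun x ↦ by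
  rw [← h₂ x, Subtype.ext_iff]
  rfl

theorem surjective_codRestrict_ker (h₁ : Function.Exact g₁ f) : Function.Surjective
    (g₁.codRestrict (LinearMap.ker f) fun x ↦ h₁.apply_apply_eq_zero x) := fun ⟨x, hx⟩ ↦ by
  obtain ⟨y, rfl⟩ := (h₁ x).1 hx
  exact ⟨y, rfl⟩

theorem projDimLE_two (hf : Function.Surjective f) (h₁ : Function.Exact g₁ f)
    (h₂ : Function.Exact g₂ g₁) (hg₂ : Function.Injective g₂) (hP₀ : Module.Projective B P₀)
    (hP₁ : Module.Projective B P₁) (hP₂ : Module.Projective B P₂) : ProjDimLE X 2 := by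
  refine ⟨P₀, hP₀, f, hf, P₁, hP₁, _, surjective_codRestrict_ker h₁, ?_⟩
  have h := LinearMap.exact_iff.1 (exact_codRestrict_ker h₁ h₂)
  exact Module.Projective.of_equiv
    ((LinearEquiv.ofInjective g₂ hg₂).trans (LinearEquiv.ofEq _ _ h.symm))

theorem ExtGroup.subsingleton_one_of_resolution {Y : ModuleCat.{u} B}
    (hf : Function.Surjective f) (h₁ : Function.Exact g₁ f) (hP₀ : Module.Projective B P₀)
    (hY : ∀ a : P₁ →ₗ[B] Y, a = 0) : Subsingleton (ExtGroup X Y 1) := by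
  refine ExtGroup.subsingleton_one_of_hom_eq_zero (K := ModuleCat.of B (LinearMap.ker f))
    (f := (LinearMap.ker f).subtype) Subtype.val_injective
    (LinearMap.exact_subtype_ker_map f) hf hP₀ fun a ↦ LinearMap.ext fun x ↦ ?_
  obtain ⟨y, rfl⟩ := surjective_codRestrict_ker h₁ x
  exact LinearMap.congr_fun (hY (a ∘ₗ g₁.codRestrict (LinearMap.ker f) _)) y

theorem ExtGroup.subsingleton_add_two_iff_ker {Y : ModuleCat.{u} B}
    (hf : Function.Surjective f) (hP₀ : Module.Projective B P₀) (n : ℕ) :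
    Subsingleton (ExtGroup X Y (n + 2)) ↔
      Subsingleton (ExtGroup (ModuleCat.of B (LinearMap.ker f)) Y (n + 1)) :=
  ExtGroup.subsingleton_succ_iff (K := ModuleCat.of B (LinearMap.ker f))
    (f := (LinearMap.ker f).subtype) Subtype.val_injective
    (LinearMap.exact_subtype_ker_map f) hf hP₀ n

theorem ExtGroup.subsingleton_two_of_resolution {Y : ModuleCat.{u} B}
    (hf : Function.Surjective f) (h₁ : Function.Exact g₁ f)
    (h₂ : Function.Exact g₂ g₁) (hg₂ : Function.Injective g₂) (hP₀ : Module.Projective B P₀)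
    (hP₁ : Module.Projective B P₁) (hY : ∀ a : P₂ →ₗ[B] Y, a = 0) :
    Subsingleton (ExtGroup X Y 2) :=
  (ExtGroup.subsingleton_add_two_iff_ker hf hP₀ 0).2
    (ExtGroup.subsingleton_one_of_hom_eq_zero (X := ModuleCat.of B (LinearMap.ker f)) hg₂
      (exact_codRestrict_ker h₁ h₂) (surjective_codRestrict_ker h₁) hP₁ hY)

theorem ExtGroup.subsingleton_add_three_of_resolution {Y : ModuleCat.{u} B}
    (hf : Function.Surjective f) (h₁ : Function.Exact g₁ f)
    (h₂ : Function.Exact g₂ g₁) (hg₂ : Function.Injective g₂) (hP₀ : Module.Projective B P₀)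
    (hP₁ : Module.Projective B P₁) (hP₂ : Module.Projective B P₂) (n : ℕ) :
    Subsingleton (ExtGroup X Y (n + 3)) :=
  (ExtGroup.subsingleton_add_two_iff_ker hf hP₀ (n + 1)).2
    ((ExtGroup.subsingleton_succ_iff (X := ModuleCat.of B (LinearMap.ker f)) hg₂
      (exact_codRestrict_ker h₁ h₂) (surjective_codRestrict_ker h₁) hP₁ n).2
      (ExtGroup.subsingleton_of_projective hP₂ n))

theorem exists_extension_of_ext_two {Y : ModuleCat.{u} B}
    (hf : Function.Surjective f) (h₁ : Function.Exact g₁ f)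
    (h₂ : Function.Exact g₂ g₁) (hg₂ : Function.Injective g₂) (hP₀ : Module.Projective B P₀)
    (hY : Subsingleton (ExtGroup X Y 2)) (a : P₂ →ₗ[B] Y) : ∃ b : P₁ →ₗ[B] Y, b ∘ₗ g₂ = a :=
  exists_extension_of_ext_one (X := ModuleCat.of B (LinearMap.ker f)) hg₂
    (exact_codRestrict_ker h₁ h₂) (surjective_codRestrict_ker h₁)
    ((ExtGroup.subsingleton_add_two_iff_ker hf hP₀ 0).1 hY) a

end Resolution

namespace PathSystem

variable {k : Type u} [Field k] {Q : GentleQuiverData.{u}} {B : Type u} [Ring B] [Algebra k B]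

theorem isIndec_of_generator (s : PathSystem Q B) {X : ModuleCat.{u} B} (v : Q.V) {g : X}
    (h0 : g ≠ 0) (hv : s.vtx v • g = g) (hg : ∀ x, ∃ b : B, b • g = x)
    (hX : ∀ x : X, ∃ c : k, s.vtx v • x = algebraMap k B c • g) : IsIndec X := by
  refine ⟨nontrivial_of_ne g 0 h0, fun Y Z ⟨φ⟩ ↦ ?_⟩
  have key (w : Y × Z) : ∃ b : B, b • φ g = w := by
    obtain ⟨b, hb⟩ := hg (φ.symm w)
    exact ⟨b, by rw [← map_smul, hb, φ.apply_symm_apply]⟩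
  obtain ⟨c, hc⟩ := hX (φ.symm ((φ g).1, 0))
  have h1 : ((φ g).1, (0 : Z)) = algebraMap k B c • φ g := by
    rw [← map_smul, ← hc, map_smul, φ.apply_symm_apply, Prod.smul_mk, smul_zero, ← Prod.smul_fst,
      ← map_smul, hv]
  rcases eq_or_ne c 0 with rfl | hc0
  · refine .inl (subsingleton_of_forall_eq 0 fun y ↦ ?_)
    have h2 : (φ g).1 = 0 := by simpa using congr_arg Prod.fst h1
    obtain ⟨b, hb⟩ := key (y, 0)
    simpa [h2] using (congr_arg Prod.fst hb).symm
  · refine .inr (subsingleton_of_forall_eq 0 fun z ↦ ?_)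
    have h2 : (φ g).2 = 0 := by
      have h3 : 0 = algebraMap k B c • (φ g).2 := congr_arg Prod.snd h1
      have h4 := congr_arg (algebraMap k B c⁻¹ • ·) h3
      simpa [← mul_smul, ← map_mul, hc0] using h4.symm
    obtain ⟨b, hb⟩ := key (0, z)
    simpa [h2] using (congr_arg Prod.snd hb).symm

section ProjectiveModule

variable (s : PathSystem Q B) (v : Q.V)

/-- The indecomposable projective module at the vertex `v`. -/
abbrev proj : ModuleCat.{u} B := ModuleCat.of B (Ideal.span {s.vtx v} : Ideal B)

variable {s v}

theorem mem_span_vtx {x : B} : x ∈ Ideal.span {s.vtx v} ↔ x * s.vtx v = x := by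
  rw [Ideal.mem_span_singleton']
  refine ⟨?_, fun h ↦ ⟨x, h⟩⟩
  rintro ⟨x, rfl⟩
  rw [mul_assoc, s.vtx_mul_self]

theorem proj_mul_vtx (x : s.proj v) : x.1 * s.vtx v = x.1 := mem_span_vtx.1 x.2

variable (s v) in
/-- The generator of the projective module at `v`. -/
def projGen : s.proj v := ⟨s.vtx v, Ideal.subset_span rfl⟩

theorem smul_projGen (x : s.proj v) : x.1 • s.projGen v = x := Subtype.ext (proj_mul_vtx x)

theorem vtx_smul_projGen : s.vtx v • s.projGen v = s.projGen v := Subtype.ext (s.vtx_mul_self v)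

variable (s v) in
theorem projective_proj : Module.Projective B (s.proj v) :=
  Module.Projective.of_split (Submodule.subtype _)
    ((LinearMap.toSpanSingleton B B (s.vtx v)).codRestrict (Ideal.span {s.vtx v}) fun x ↦
      Ideal.mul_mem_left _ x (Ideal.subset_span rfl))
    (LinearMap.ext fun x ↦ Subtype.ext (proj_mul_vtx x))

variable {N : ModuleCat.{u} B}

variable (s v) in
/-- The map from the projective module at `v` determined by an element. -/
def projHom (n : N) : s.proj v →ₗ[B] N :=
  LinearMap.toSpanSingleton B N n ∘ₗ Submodule.subtype _

theorem projHom_projGen {n : N} (hn : s.vtx v • n = n) : s.projHom v n (s.projGen v) = n := hn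

theorem hom_proj_eq_zero (h : ∀ n : N, s.vtx v • n = 0) (f : s.proj v →ₗ[B] N) : f = 0 :=
  LinearMap.ext fun x ↦ by
    rw [← smul_projGen x, map_smul, ← vtx_smul_projGen, map_smul, h, smul_zero,
      LinearMap.zero_apply]

end ProjectiveModule

theorem IsUniversal.vtx_ne_zero {s : PathSystem Q B} (hs : s.IsUniversal k) (v : Q.V) :
    s.vtx v ≠ 0 := by
  obtain ⟨S, ⟨hS⟩⟩ := hs.exists_simpleAt v
  intro h
  have := hS.vtx_smul_self (hS.toField.symm 1)
  rw [h, zero_smul, eq_comm, map_eq_zero_iff _ hS.toField.symm.injective] at this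
  exact one_ne_zero this

theorem SimpleAt.exists_smul_eq {s : PathSystem Q B} {v : Q.V} {S : ModuleCat.{u} B}
    (hS : SimpleAt k s v S) (x : S) :
    algebraMap k B (hS.toField x) • hS.toField.symm 1 = x :=
  hS.toField.injective (by simp [hS.map_algebraMap_smul])

theorem SimpleAt.isIndec {s : PathSystem Q B} {v : Q.V} {S : ModuleCat.{u} B}
    (hS : SimpleAt k s v S) : IsIndec S :=
  s.isIndec_of_generator (k := k) v (g := hS.toField.symm 1) (by simp) (hS.vtx_smul_self _)
    (fun x ↦ ⟨_, hS.exists_smul_eq x⟩)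
    (fun x ↦ ⟨hS.toField x, by rw [hS.exists_smul_eq, hS.vtx_smul_self]⟩)

end PathSystem

namespace GentleExample

open PathSystem

variable {k : Type u} [Field k] {r : ℕ} {B : Type u} [Ring B] [Algebra k B]
  {s : PathSystem (quiver.{u} r) B}

section Tail

variable (hs : s.IsUniversal k)
include hs

theorem exists_eq_of_proj_tail (i : Fin r) (x : s.proj (.p i.succ)) : ∃ c c' : k,
    x.1 = c • s.vtx (.p i.succ) + c' • s.arr (.d i) := by
  obtain ⟨c, x', h⟩ := mul_vtx_p_succ hs i x.1
  obtain ⟨c', h'⟩ := mul_arr_d hs i x'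
  exact ⟨c, c', by rw [← proj_mul_vtx x, h, h']⟩

theorem vtx_smul_proj_tail {i : Fin r} {v : (quiver.{u} r).V} (h1 : v ≠ .p i.succ)
    (h2 : v ≠ .p i.castSucc) (x : s.proj (.p i.succ)) : s.vtx v • x = 0 := by
  obtain ⟨c, c', h⟩ := exists_eq_of_proj_tail hs i x
  refine Subtype.ext ?_
  change s.vtx v * x.1 = 0
  rw [h, mul_add, mul_smul_comm, mul_smul_comm, s.vtx_mul_vtx _ _ h1,
    s.vtx_mul_arr (y := .d i) h2, smul_zero, smul_zero, add_zero]

theorem isIndec_proj_tail (i : Fin r) : IsIndec (s.proj (.p i.succ)) := by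
  refine s.isIndec_of_generator (k := k) (.p i.succ) (g := s.projGen (.p i.succ))
    (fun h ↦ hs.vtx_ne_zero _ (congr_arg Subtype.val h)) vtx_smul_projGen
    (fun x ↦ ⟨_, smul_projGen x⟩) fun x ↦ ?_
  obtain ⟨c, c', h⟩ := exists_eq_of_proj_tail hs i x
  refine ⟨c, Subtype.ext ?_⟩
  change s.vtx _ * x.1 = algebraMap k B c * s.vtx _
  have h2 : (Vertex.p i.succ : (quiver.{u} r).V) ≠ (quiver r).tgt (.d i) := by
    simp [Arrow.tgt, Fin.castSucc_lt_succ.ne']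
  rw [h, mul_add, mul_smul_comm, mul_smul_comm, s.vtx_mul_self, s.vtx_mul_arr h2, smul_zero,
    add_zero, Algebra.smul_def]

theorem isEmpty_equiv_proj_tail {i j : Fin r} (h : i < j) :
    IsEmpty (s.proj (.p i.succ) ≃ₗ[B] s.proj (.p j.succ)) := by
  refine ⟨fun φ ↦ hs.vtx_ne_zero (.p j.succ) ?_⟩
  have h1 : φ (φ.symm (s.projGen _)) = 0 := by
    rw [← vtx_smul_projGen, map_smul, vtx_smul_proj_tail hs, map_zero]
    · simpa using h.ne'
    · simpa using (Fin.castSucc_lt_succ.trans (Fin.succ_lt_succ_iff.2 h)).ne'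
  rw [φ.apply_symm_apply] at h1
  exact congr_arg Subtype.val h1

theorem isEmpty_equiv_simple {S : ModuleCat.{u} B} (hS : SimpleAt k s (.p 0) S) (j : Fin r) :
    IsEmpty (S ≃ₗ[B] s.proj (.p j.succ)) := by
  refine ⟨fun φ ↦ hs.vtx_ne_zero (.p j.succ) ?_⟩
  have h1 : φ (φ.symm (s.projGen _)) = 0 := by
    rw [← vtx_smul_projGen, map_smul, hS.vtx_smul, map_zero]
    simp
  rw [φ.apply_symm_apply] at h1
  exact congr_arg Subtype.val h1

end Tail

variable {l : ℕ} (t : Fin l → Fin r)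

variable (s) in
/-- The indecomposable summands of the pre-tilting module. -/
noncomputable def summand (S : ModuleCat.{u} B) : Fin (l + 1) → ModuleCat.{u} B :=
  Fin.cons S fun j ↦ s.proj (.p (t j).succ)

variable (s) in
/-- The sum of the projective modules at the chosen vertices of the tail. -/
abbrev tail : ModuleCat.{u} B := ModuleCat.of B ((j : Fin l) → s.proj (.p (t j).succ))

theorem isIndecDecomp_summand (hs : s.IsUniversal k) (ht : StrictMono t) {S : ModuleCat.{u} B}
    (hS : SimpleAt k s (.p 0) S) : IsIndecDecomp (dSum S (tail s t)) (summand s t S) := by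
  have key (i j : Fin (l + 1)) (h : i < j) :
      IsEmpty (summand s t S i ≃ₗ[B] summand s t S j) := by
    induction j using Fin.cases with
    | zero => exact absurd h (Fin.not_lt_zero i)
    | succ j =>
      induction i using Fin.cases with
      | zero => exact isEmpty_equiv_simple hs hS (t j)
      | succ i => exact isEmpty_equiv_proj_tail hs (ht (Fin.succ_lt_succ_iff.1 h))
  refine ⟨fun i ↦ ?_, fun i j h ↦ ?_, ⟨Fin.consLinearEquiv B fun i ↦ summand s t S i⟩⟩
  · induction i using Fin.cases with
    | zero => exact hS.isIndec
    | succ i => exact isIndec_proj_tail hs (t i)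
  · rcases h.lt_or_gt with h | h
    · exact key i j h
    · exact ⟨fun φ ↦ (key j i h).elim φ.symm⟩

section Resolution

variable {S : ModuleCat.{u} B} (hS : SimpleAt k s (.p 0) S)

/-- The projective cover of the pre-tilting module. -/
noncomputable def cover : ModuleCat.of B (s.proj (.p 0) × tail s t) →ₗ[B] dSum S (tail s t) :=
  (s.projHom (.p 0) (hS.toField.symm 1)).prodMap LinearMap.id

variable (s) in
/-- The first differential of the projective resolution. -/
noncomputable def firstDiff : s.proj .y →ₗ[B] ModuleCat.of B (s.proj (.p 0) × tail s t) :=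
  LinearMap.inl B _ _ ∘ₗ s.projHom .y ⟨s.arr .a, mem_span_vtx.2 (s.arr_mul_src .a)⟩

variable (s) in
/-- The second differential of the projective resolution. -/
noncomputable def secondDiff : s.proj .z →ₗ[B] s.proj .y :=
  s.projHom .z ⟨s.arr .b, mem_span_vtx.2 (s.arr_mul_src .b)⟩

theorem surjective_cover : Function.Surjective (cover t hS) := by
  rintro ⟨x, y⟩
  refine ⟨(algebraMap k B (hS.toField x) • s.projGen (.p 0), y), Prod.ext ?_ rfl⟩
  change s.projHom _ _ (algebraMap k B (hS.toField x) • s.projGen (.p 0)) = x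
  rw [map_smul, projHom_projGen (hS.vtx_smul_self _), hS.exists_smul_eq]

theorem projective_cover (t : Fin l → Fin r) :
    Module.Projective B (ModuleCat.of B (s.proj (.p 0) × tail s t)) := by
  have (v : (quiver.{u} r).V) : Module.Projective B (s.proj v) := projective_proj s v
  have h2 : Module.Projective B (Π₀ j : Fin l, s.proj (.p (t j).succ)) := inferInstance
  have : Module.Projective B (tail s t) := Module.Projective.of_equiv
    (DFinsupp.linearEquivFunOnFintype (R := B) (M := fun j ↦ s.proj (.p (t j).succ)))
  exact inferInstanceAs (Module.Projective B (s.proj (.p 0) × tail s t))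

include hS in
theorem finite_dSum : Module.Finite B (dSum S (tail s t)) := by
  have (v : (quiver.{u} r).V) : Module.Finite B (s.proj v) :=
    Module.Finite.span_singleton B (s.vtx v)
  have : Module.Finite B (tail s t) :=
    inferInstanceAs (Module.Finite B ((j : Fin l) → s.proj (.p (t j).succ)))
  have : Module.Finite B (ModuleCat.of B (s.proj (.p 0) × tail s t)) :=
    inferInstanceAs (Module.Finite B (s.proj (.p 0) × tail s t))
  exact .of_surjective (cover t hS) (surjective_cover t hS)

variable (hs : s.IsUniversal k)
include hs

theorem exact_firstDiff : Function.Exact (firstDiff s t) (cover t hS) := by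
  rintro ⟨x, y⟩
  constructor
  · intro h
    have h1 : x.1 • hS.toField.symm 1 = 0 := congr_arg Prod.fst h
    have h2 : y = 0 := congr_arg Prod.snd h
    obtain ⟨c, x', h3⟩ := mul_vtx_p_zero hs x.1
    rw [proj_mul_vtx] at h3
    have h4 := congr_arg hS.toField h1
    rw [h3, add_smul, mul_smul, hS.arr_smul, smul_zero, add_zero, Algebra.smul_def, mul_smul,
      hS.vtx_smul_self, hS.map_algebraMap_smul] at h4
    have h5 : c = 0 := by simpa using h4
    refine ⟨x' • s.projGen .y, Prod.ext (Subtype.ext ?_) h2.symm⟩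
    change x' * s.vtx .y * s.arr .a = x.1
    rw [h3, h5, zero_smul, zero_add, mul_assoc, vtx_y_mul_arr_a]
  · rintro ⟨x', h⟩
    rw [← h]
    refine Prod.ext ?_ rfl
    change (x'.1 * s.arr .a) • hS.toField.symm 1 = 0
    rw [mul_smul, hS.arr_smul, smul_zero]

theorem exact_secondDiff : Function.Exact (secondDiff s) (firstDiff s t) := by
  intro x
  have h : firstDiff s t x = 0 ↔ x.1 * s.arr .a = 0 :=
    ⟨fun h ↦ congr_arg (fun w ↦ (Prod.fst w).1) h, fun h ↦ Prod.ext (Subtype.ext h) rfl⟩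
  rw [h]
  constructor
  · intro h
    obtain ⟨x', h'⟩ := exists_mul_arr_b hs (proj_mul_vtx x) h
    refine ⟨x' • s.projGen .z, Subtype.ext ?_⟩
    change x' * s.vtx .z * s.arr .b = x.1
    rw [mul_assoc, vtx_z_mul_arr_b, h']
  · rintro ⟨x', rfl⟩
    change x'.1 * s.arr .b * s.arr .a = 0
    rw [mul_assoc, arr_b_mul_arr_a, mul_zero]

theorem injective_secondDiff : Function.Injective (secondDiff s) :=
  (injective_iff_map_eq_zero _).2 fun x hx ↦ Subtype.ext
    (eq_zero_of_mul_arr_b hs (proj_mul_vtx x) (congr_arg Subtype.val hx))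

include hS in
theorem vtx_smul_dSum {v : (quiver.{u} r).V} (hv : ∀ i, v ≠ .p i) (x : dSum S (tail s t)) :
    s.vtx v • x = 0 :=
  Prod.ext (hS.vtx_smul v (hv 0) _) (funext fun _ ↦ vtx_smul_proj_tail hs (hv _) (hv _) _)

include hS in
theorem isPreTilting : IsPreTilting (dSum S (tail s t)) := by
  have h0 := projective_cover (s := s) t
  have h1 := projective_proj s .y
  have h2 := projective_proj s .z
  have hf := surjective_cover t hS
  have e1 := exact_firstDiff t hS hs
  have e2 := exact_secondDiff t hs
  have i2 := injective_secondDiff hs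
  refine ⟨⟨2, projDimLE_two hf e1 e2 i2 h0 h1 h2⟩, fun i hi ↦ ?_⟩
  obtain _ | _ | _ | i := i
  · exact absurd hi (lt_irrefl 0)
  · exact ExtGroup.subsingleton_one_of_resolution hf e1 h0
      (hom_proj_eq_zero (vtx_smul_dSum t hS hs (by simp)))
  · exact ExtGroup.subsingleton_two_of_resolution hf e1 e2 i2 h0 h1
      (hom_proj_eq_zero (vtx_smul_dSum t hS hs (by simp)))
  · exact ExtGroup.subsingleton_add_three_of_resolution hf e1 e2 i2 h0 h1 h2 i

end Resolution

variable {S : ModuleCat.{u} B}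
  (hS : SimpleAt k s (.p 0) S) (hs : s.IsUniversal k)
include hs

include hS in
theorem arr_b_surjective {N : ModuleCat.{u} B}
    (hN : Subsingleton (ExtGroup (dSum S (tail s t)) N 2)) {n : N} (hn : s.vtx .z • n = n) :
    ∃ n' : N, s.vtx .y • n' = n' ∧ s.arr .b • n' = n := by
  obtain ⟨f, hf⟩ := exists_extension_of_ext_two (surjective_cover t hS) (exact_firstDiff t hS hs)
    (exact_secondDiff t hs) (injective_secondDiff hs) (projective_cover t) hN (s.projHom .z n)
  refine ⟨f (s.projGen .y), by rw [← map_smul, vtx_smul_projGen], ?_⟩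
  rw [← projHom_projGen hn, ← hf, LinearMap.comp_apply, ← map_smul]
  congr 1
  refine Subtype.ext ?_
  change s.arr .b * s.vtx .y = s.vtx .z * s.arr .b
  rw [vtx_z_mul_arr_b]
  exact s.arr_mul_src .b

include hS in
theorem arr_a_smul_eq_zero {N : ModuleCat.{u} B} [Module.Finite B N]
    (h1 : Subsingleton (ExtGroup (dSum S (tail s t)) N 2)) (h2 : Subsingleton (ExtGroup N S 2))
    (n : N) : s.arr .a • n = 0 := by
  have := finiteDimensional hs
  let : Module k N := Module.compHom N (algebraMap k B)
  have : IsScalarTower k B N := ⟨fun c b x ↦ by rw [Algebra.smul_def, mul_smul]; rfl⟩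
  have : Module.Finite k N := .trans B N
  have mem {v} {n : N} : n ∈ LinearMap.range (Algebra.lsmul k k N (s.vtx v)) ↔
      s.vtx v • n = n := by
    refine ⟨?_, fun h ↦ ⟨n, h⟩⟩
    rintro ⟨n, rfl⟩
    simp [← mul_smul, s.vtx_mul_self]
  let Ny := LinearMap.range (Algebra.lsmul k k N (s.vtx .y))
  let Nz := LinearMap.range (Algebra.lsmul k k N (s.vtx .z))
  let b : Ny →ₗ[k] Nz := (Algebra.lsmul k k N (s.arr .b)).restrict fun n _ ↦
    mem.2 (by simp [← mul_smul, vtx_z_mul_arr_b])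
  let e : Ny →ₗ[k] Nz := (Algebra.lsmul k k N (s.arr .e)).restrict fun n _ ↦
    mem.2 (by simp [← mul_smul, vtx_z_mul_arr_e])
  have hb : Function.Surjective b := fun ⟨n, hn⟩ ↦ by
    obtain ⟨n', h, rfl⟩ := arr_b_surjective t hS hs h1 (mem.1 hn)
    exact ⟨⟨n', mem.2 h⟩, rfl⟩
  have he : Function.Injective e := (injective_iff_map_eq_zero _).2 fun ⟨n, hn⟩ h ↦
    Subtype.ext (hs.eq_zero_of_ext_two .e .c trivial
      (by rintro (_ | _ | _ | _ | _) h <;> simp_all [Arrow.rel, Arrow.tgt, Arrow.src])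
      (by rintro (_ | _ | _ | _ | _) h <;> simp_all [Arrow.rel, Arrow.tgt, Arrow.src])
      hS h2 (mem.1 hn) (congr_arg Subtype.val h))
  have hfin : Module.finrank k Ny = Module.finrank k Nz :=
    le_antisymm (LinearMap.finrank_le_finrank_of_injective he)
      (LinearMap.finrank_le_finrank_of_surjective hb)
  have hb' : Function.Injective b :=
    (LinearMap.injective_iff_surjective_of_finrank_eq_finrank hfin).2 hb
  have h3 : (⟨s.arr .a • n, mem.2 (by rw [← mul_smul, vtx_y_mul_arr_a])⟩ : Ny) = 0 :=
    hb' (Subtype.ext (by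
      change s.arr .b • s.arr .a • n = s.arr .b • 0
      rw [← mul_smul, arr_b_mul_arr_a, zero_smul, smul_zero]))
  exact congr_arg Subtype.val h3

include hS in
theorem not_isTilting (N : ModuleCat.{u} B) [Module.Finite B N] :
    ¬ IsTilting (dSum (dSum S (tail s t)) N) := by
  rintro ⟨-, hT, d, hd⟩
  have h1 : Subsingleton (ExtGroup (dSum S (tail s t)) N 2) :=
    ExtGroup.subsingleton_of_retract (hT 2 two_pos) (LinearMap.inl B _ _) (LinearMap.fst B _ _) rfl
      (LinearMap.inr B _ _) (LinearMap.snd B _ _) rfl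
  have h2 : Subsingleton (ExtGroup N S 2) :=
    ExtGroup.subsingleton_of_retract (hT 2 two_pos) (LinearMap.inr B _ _) (LinearMap.snd B _ _) rfl
      (LinearMap.inl B (dSum S (tail s t)) N ∘ₗ LinearMap.inl B S (tail s t))
      (LinearMap.fst B S (tail s t) ∘ₗ LinearMap.fst B (dSum S (tail s t)) N) rfl
  refine arr_a_ne_zero hs ?_
  rw [← mul_one (s.arr .a)]
  refine hd.smul_eq_zero (b := s.arr .a) (fun x ↦ ?_) (1 : B)
  refine Prod.ext ?_ (arr_a_smul_eq_zero t hS hs h1 h2 _)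
  change s.arr .a • x.1 = 0
  rw [← vtx_y_mul_arr_a, mul_smul, vtx_smul_dSum t hS hs (by simp)]

end GentleExample

/-- For all `n ≥ 3` and `1 ≤ m ≤ n - 2` and any algebraically closed field `k`,
there is a connected gentle algebra of rank `n` and a pre-tilting module with exactly `m`
pairwise non-isomorphic indecomposable summands which is not partial-tilting. -/
theorem exists_pretilting_not_partial_tilting
    (n m : ℕ) (hn : 3 ≤ n) (hm1 : 1 ≤ m) (hm2 : m ≤ n - 2)
    (k : Type u) [Field k] [IsAlgClosed k] :
    ∃ Q : GentleQuiverData.{u},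
      Q.Connected ∧ Fintype.card Q.V = n ∧ FiniteDimensional k (GentleAlg k Q) ∧
      ∃ M : ModuleCat.{u} (GentleAlg k Q)ᵐᵒᵖ,
        Module.Finite (GentleAlg k Q)ᵐᵒᵖ M ∧ IsPreTilting M ∧ HasRank M m ∧
        ¬ ∃ N : ModuleCat.{u} (GentleAlg k Q)ᵐᵒᵖ,
            Module.Finite (GentleAlg k Q)ᵐᵒᵖ N ∧ IsTilting (dSum M N) := by
  obtain ⟨r, rfl⟩ := Nat.exists_eq_add_of_le' hn
  obtain ⟨l, rfl⟩ := Nat.exists_eq_add_of_le' hm1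
  have hl : l ≤ r := by omega
  have hs : (PathSystem.gentle k (GentleExample.quiver.{u} r)).IsUniversal k :=
    PathSystem.isUniversal_gentle
  obtain ⟨S, ⟨hS⟩⟩ := hs.exists_simpleAt (.p 0)
  have := GentleExample.finiteDimensional hs
  have ht := Fin.strictMono_castLE hl
  exact ⟨GentleExample.quiver r, GentleExample.connected_quiver r, GentleExample.Vertex.card_eq r,
    Module.Finite.equiv (MulOpposite.opLinearEquiv k).symm, _,
    GentleExample.finite_dSum (Fin.castLE hl) hS, GentleExample.isPreTilting _ hS hs,
    ⟨_, GentleExample.isIndecDecomp_summand _ hs ht hS⟩,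
    fun ⟨N, _, h⟩ ↦ GentleExample.not_isTilting _ hS hs N h⟩
end

section
/- Let A be a gentle algebra. Then every self-orthogonal A-module (a finite-dimensional module T with Ext^i_A(T,T) = 0 for all i > 0) has finite projective dimension; in particular, every self-orthogonal A-module is a pre-tilting module. -/
open CategoryTheory

universe u

variable (k : Type u) [Field k]

universe w

/-- A projective resolution `⋯ → K 1 → K 0 → X → 0` of a module, in terms of linear maps. -/
structure ProjRes {B : Type u} [Ring B] (X : ModuleCat.{u} B) : Type (u + 1) where
  /-- the terms -/
  K : ℕ → ModuleCat.{u} B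
  proj : ∀ n, Module.Projective B (K n)
  /-- the differentials -/
  d : ∀ n, K (n + 1) →ₗ[B] K n
  /-- the augmentation -/
  aug : K 0 →ₗ[B] X
  aug_surj : Function.Surjective aug
  exact_aug : Function.Exact (d 0) aug
  exact : ∀ n, Function.Exact (d (n + 1)) (d n)

namespace ProjRes

variable {B : Type u} [Ring B] {X : ModuleCat.{u} B}

/-- The induced resolution of the first syzygy. -/
def shift (P : ProjRes X) : ProjRes (ModuleCat.of B (LinearMap.ker P.aug)) where
  K n := P.K (n + 1)
  proj n := P.proj (n + 1)
  d n := P.d (n + 1)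
  aug := LinearMap.codRestrict _ (P.d 0) fun x => (P.exact_aug _).2 ⟨x, rfl⟩
  aug_surj := by
    rintro ⟨y, hy⟩
    obtain ⟨x, rfl⟩ := (P.exact_aug y).1 hy
    exact ⟨x, rfl⟩
  exact_aug := fun x => by
    rw [← P.exact 0 x]
    exact Subtype.ext_iff
  exact n := P.exact (n + 1)

/-- If some syzygy is projective then the projective dimension is finite. -/
theorem hasFiniteProjDim_of_projective_ker (n : ℕ) {X : ModuleCat.{u} B} (P : ProjRes X)
    (h : Module.Projective B (LinearMap.ker (P.d n))) : HasFiniteProjDim X := by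
  induction n generalizing X with
  | zero =>
    have e : LinearMap.ker P.shift.aug = LinearMap.ker (P.d 0) := by
      ext x
      exact Subtype.ext_iff
    refine ⟨2, P.K 0, P.proj 0, P.aug, P.aug_surj, P.K 1, P.proj 1, P.shift.aug,
      P.shift.aug_surj, ?_⟩
    exact Module.Projective.of_equiv (LinearEquiv.ofEq _ _ e.symm)
  | succ n ih =>
    obtain ⟨m, hm⟩ := ih P.shift h
    exact ⟨m + 1, P.K 0, P.proj 0, P.aug, P.aug_surj, hm⟩

open Abelian in
/-- Vanishing of `Ext^(n+1)(X, Y)` means that every `Y`-valued cocycle is a coboundary. -/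
theorem exists_comp_eq_of_subsingleton_ext [HasExt.{w} (ModuleCat.{u} B)] (n : ℕ)
    {X : ModuleCat.{u} B} (P : ProjRes X) (Y : ModuleCat.{u} B)
    (h : Subsingleton (Ext X Y (n + 1))) (φ : P.K (n + 1) →ₗ[B] Y)
    (hφ : ∀ x, φ (P.d (n + 1) x) = 0) :
    ∃ ψ : P.K n →ₗ[B] Y, ∀ x, ψ (P.d n x) = φ x := by
  have hS := LinearMap.shortExact_shortComplexKer P.aug_surj
  have : Projective P.aug.shortComplexKer.X₂ :=
    (IsProjective.iff_projective (P.K 0)).1 (P.proj 0)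
  induction n generalizing X with
  | zero =>
    change P.shift.K 0 →ₗ[B] Y at φ
    have hker : LinearMap.ker P.shift.aug ≤ LinearMap.ker φ := fun x hx => by
      obtain ⟨y, rfl⟩ := (P.shift.exact_aug x).1 hx
      exact hφ y
    let e := P.shift.aug.quotKerEquivOfSurjective P.shift.aug_surj
    let φ' : LinearMap.ker P.aug →ₗ[B] Y := (Submodule.liftQ _ φ hker).comp e.symm.toLinearMap
    have hφ' : ∀ x, φ' (P.shift.aug x) = φ x := fun x => by
      have : e.symm (P.shift.aug x) = Submodule.Quotient.mk x := by
        rw [LinearEquiv.symm_apply_eq]; rfl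
      change Submodule.liftQ _ φ hker (e.symm (P.shift.aug x)) = φ x
      rw [this]
      rfl
    obtain ⟨ψ, hψ⟩ := Ext.contravariant_sequence_exact₁ hS Y
      (Ext.mk₀ (ModuleCat.ofHom φ')) (add_zero 1) (h.elim _ _)
    obtain ⟨g, rfl⟩ := Ext.addEquiv₀.symm.surjective ψ
    refine ⟨g.hom, fun x => ?_⟩
    have h1 : P.aug.shortComplexKer.f ≫ g = ModuleCat.ofHom φ' := by
      apply Ext.addEquiv₀.symm.injective
      simpa using hψ
    exact (congrArg (fun f => f.hom (P.shift.aug x)) h1).trans (hφ' x)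
  | succ n ih =>
    have h' : Subsingleton (Ext (ModuleCat.of B (LinearMap.ker P.aug)) Y (n + 1)) := by
      refine subsingleton_of_forall_eq 0 fun x => ?_
      obtain ⟨y, hy⟩ := Ext.contravariant_sequence_exact₁ hS Y x (add_comm 1 (n + 1)) (h.elim _ _)
      rw [← hy, Ext.eq_zero_of_projective y, Ext.comp_zero]
    exact ih P.shift h' φ hφ (LinearMap.shortExact_shortComplexKer P.shift.aug_surj)
      ((IsProjective.iff_projective (P.K 1)).1 (P.proj 1))

/-- A module with a projective resolution that is eventually periodic, the periodicity being
induced by a chain map defined in all degrees, has finite projective dimension as soon as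
the corresponding self-extension group vanishes. -/
theorem hasFiniteProjDim_of_periodic [HasExt.{w} (ModuleCat.{u} B)] (P : ProjRes X) (M : ℕ)
    (h : Subsingleton (Abelian.Ext X X (M + 1)))
    (χ : ∀ n, P.K (M + n + 1) →ₗ[B] P.K n)
    (hχ : ∀ n x, P.d n (χ (n + 1) x) = χ n (P.d (M + n + 1) x))
    (m : ℕ) (hm : ∀ n, m ≤ n → Function.Bijective (χ n)) : HasFiniteProjDim X := by
  have := P.proj
  have key : ∀ n, ∃ (s : P.K (M + n) →ₗ[B] P.K n) (t : P.K (M + n + 1) →ₗ[B] P.K (n + 1)),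
      ∀ x, P.d n (t x) = χ n x - s (P.d (M + n) x) := by
    intro n
    induction n with
    | zero =>
      obtain ⟨ψ, hψ⟩ := P.exists_comp_eq_of_subsingleton_ext M X h (P.aug.comp (χ 0)) fun x => by
        have := hχ 0 x
        change P.aug (χ 0 (P.d (M + 0 + 1) x)) = 0
        rw [← this]
        exact (P.exact_aug _).2 ⟨_, rfl⟩
      obtain ⟨s, hs⟩ := Module.projective_lifting_property P.aug ψ P.aug_surj
      have hz : ∀ x, P.aug ((χ 0 - s.comp (P.d M)) x) = 0 := fun x => by
        have := hψ x
        rw [← hs] at this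
        simp only [LinearMap.comp_apply] at this
        simp [this]
      obtain ⟨t, ht⟩ := Module.projective_lifting_property P.shift.aug
        (LinearMap.codRestrict (LinearMap.ker P.aug) (χ 0 - s.comp (P.d M)) hz) P.shift.aug_surj
      exact ⟨s, t, fun x => congrArg Subtype.val (LinearMap.congr_fun ht x)⟩
    | succ n ih =>
      obtain ⟨s, t, hst⟩ := ih
      have hz : ∀ x, (χ (n + 1) - t.comp (P.d (M + n + 1))) x ∈ LinearMap.range (P.d (n + 1)) :=
        fun x => by
        refine (P.exact n _).1 ?_
        have h0 : P.d (M + n) (P.d (M + n + 1) x) = 0 := (P.exact (M + n) _).2 ⟨x, rfl⟩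
        simp [hχ, hst, h0]
      obtain ⟨r, hr⟩ := Module.projective_lifting_property (P.d (n + 1)).rangeRestrict
        (LinearMap.codRestrict (LinearMap.range (P.d (n + 1))) _ hz)
        (P.d (n + 1)).surjective_rangeRestrict
      exact ⟨t, r, fun x => congrArg Subtype.val (LinearMap.congr_fun hr x)⟩
  obtain ⟨s, t, hst⟩ := key m
  let e := LinearEquiv.ofBijective (χ (m + 1)) (hm _ (Nat.le_succ m))
  let r : P.K (M + m + 1) →ₗ[B] LinearMap.ker (P.d (M + m)) :=
    LinearMap.codRestrict _ ((P.d (M + m + 1)).comp (e.symm.toLinearMap.comp t))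
      fun x => (P.exact (M + m) _).2 ⟨_, rfl⟩
  refine P.hasFiniteProjDim_of_projective_ker (M + m)
    (Module.Projective.of_split (LinearMap.ker (P.d (M + m))).subtype r ?_)
  ext ⟨x, hx⟩
  apply (hm m le_rfl).1
  have he : χ (m + 1) (e.symm (t x)) = t x := e.apply_symm_apply (t x)
  have := hχ m (e.symm (t x))
  rw [LinearMap.mem_ker] at hx
  change χ m (P.d (M + m + 1) (e.symm (t x))) = χ m x
  rw [← this, he, hst, hx, map_zero, sub_zero]

end ProjRes

namespace GentleQuiverData

variable (Q : GentleQuiverData.{u})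

/-- `Q.Chain n a b`: there is a sequence `a = a₀, a₁, …, aₙ = b` of arrows in which any two
consecutive arrows form a relation. -/
def Chain : ℕ → Q.E → Q.E → Prop
  | 0, a, b => a = b
  | n + 1, a, b => ∃ c, Chain n a c ∧ Q.rel c b

/-- An arrow from which arbitrarily long chains of relations start, that is, an arrow lying
on a cycle with full relations. -/
def Cyclic (a : Q.E) : Prop := ∀ n, ∃ b, Q.Chain n a b

variable {Q}

theorem Chain.add {m n : ℕ} {a b c : Q.E} (h : Q.Chain m a b) (h' : Q.Chain n b c) :
    Q.Chain (m + n) a c := by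
  induction n generalizing c with
  | zero => obtain rfl : b = c := h'; exact h
  | succ n ih =>
    obtain ⟨d, hd, hr⟩ := h'
    exact ⟨d, ih hd, hr⟩

theorem Chain.right_unique {n : ℕ} {a b c : Q.E} (h : Q.Chain n a b) (h' : Q.Chain n a c) :
    b = c := by
  induction n generalizing b c with
  | zero => exact h.symm.trans h'
  | succ n ih =>
    obtain ⟨d, hd, hr⟩ := h
    obtain ⟨d', hd', hr'⟩ := h'
    obtain rfl := ih hd hd'
    exact Q.rel_right_unique _ _ _ hr hr'

theorem Chain.add_iff {m n : ℕ} {a b c : Q.E} (h : Q.Chain m a b) :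
    Q.Chain (m + n) a c ↔ Q.Chain n b c := by
  refine ⟨fun h' => ?_, h.add⟩
  induction n generalizing c with
  | zero => exact h.right_unique h'
  | succ n ih =>
    obtain ⟨d, hd, hr⟩ := h'
    exact ⟨d, ih hd, hr⟩

theorem Chain.cons {n : ℕ} {a b c : Q.E} (h : Q.rel a b) (h' : Q.Chain n b c) :
    Q.Chain (n + 1) a c :=
  (add_comm n 1) ▸ Chain.add (m := 1) (⟨a, rfl, h⟩ : Q.Chain 1 a b) h'

theorem Chain.exists_rel {n : ℕ} {a c : Q.E} (h : Q.Chain (n + 1) a c) :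
    ∃ b, Q.rel a b ∧ Q.Chain n b c := by
  induction n generalizing c with
  | zero =>
    obtain ⟨d, hd, hr⟩ := h
    obtain rfl : a = d := hd
    exact ⟨c, hr, rfl⟩
  | succ n ih =>
    obtain ⟨d, hd, hr⟩ := h
    obtain ⟨b, hb, hc⟩ := ih hd
    exact ⟨b, hb, d, hc, hr⟩

theorem Chain.tail {n : ℕ} {a b c : Q.E} (h : Q.Chain (n + 1) a c) (hr : Q.rel a b) :
    Q.Chain n b c := by
  obtain ⟨d, hd, hc⟩ := h.exists_rel
  rwa [Q.rel_right_unique _ _ _ hr hd]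

theorem Chain.dropLast {n : ℕ} {a b c : Q.E} (h : Q.Chain (n + 1) a c) (hr : Q.rel b c) :
    Q.Chain n a b := by
  obtain ⟨d, hd, hc⟩ := h
  rwa [Q.rel_left_unique _ _ _ hr hc]

theorem cyclic_iff_of_rel {a b : Q.E} (h : Q.rel a b) : Q.Cyclic a ↔ Q.Cyclic b := by
  refine ⟨fun ha n => ?_, fun hb n => ?_⟩
  · obtain ⟨c, hc⟩ := ha (n + 1)
    exact ⟨c, hc.tail h⟩
  · cases n with
    | zero => exact ⟨a, rfl⟩
    | succ n =>
      obtain ⟨c, hc⟩ := hb n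
      exact ⟨c, hc.cons h⟩

variable (Q)

theorem exists_chain_self_of_cyclic : ∃ N, 0 < N ∧ ∀ a, Q.Cyclic a → Q.Chain N a a := by
  classical
  have hnext : ∀ a : {a // Q.Cyclic a}, ∃ b : {b // Q.Cyclic b}, Q.rel a b := fun a => by
    obtain ⟨b, c, rfl : a.1 = c, hb⟩ := a.2 1
    exact ⟨⟨b, (cyclic_iff_of_rel hb).1 a.2⟩, hb⟩
  choose s hs using hnext
  have hinj : Function.Injective s := fun a b hab =>
    Subtype.ext (Q.rel_left_unique _ _ _ (hs a) (hab ▸ hs b))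
  let σ : Equiv.Perm {a // Q.Cyclic a} :=
    Equiv.ofBijective s (Finite.injective_iff_bijective.1 hinj)
  have hσ : ∀ (n : ℕ) a, Q.Chain n a.1 ((σ ^ n) a).1 := fun n a => by
    induction n with
    | zero => rfl
    | succ n ih => exact ⟨_, ih, by rw [pow_succ']; exact hs _⟩
  refine ⟨orderOf σ, orderOf_pos σ, fun a ha => ?_⟩
  simpa [pow_orderOf_eq_one] using hσ (orderOf σ) ⟨a, ha⟩

theorem exists_forall_chain_cyclic : ∃ m, ∀ n, m ≤ n → ∀ a b, Q.Chain n a b → Q.Cyclic a := by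
  have h : ∀ a, ∃ m, ∀ n, m ≤ n → ∀ b, Q.Chain n a b → Q.Cyclic a := by
    intro a
    by_cases ha : Q.Cyclic a
    · exact ⟨0, fun _ _ _ _ => ha⟩
    · obtain ⟨m, hm⟩ := not_forall.1 ha
      refine ⟨m, fun n hn b hb => (hm ?_).elim⟩
      obtain ⟨l, rfl⟩ := Nat.exists_eq_add_of_le hn
      clear hn
      induction l generalizing b with
      | zero => exact ⟨b, hb⟩
      | succ l ih => obtain ⟨c, hc, -⟩ := hb; exact ih c hc
  choose m hm using h
  refine ⟨Finset.univ.sup m, fun n hn a b hab => hm a n ?_ b hab⟩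
  exact (Finset.le_sup (Finset.mem_univ a)).trans hn

end GentleQuiverData

open scoped Classical in
/-- Generators `e v`, `x a` of an algebra `B` satisfying the relations of the opposite of a
gentle algebra, together with operators `D b` which strip the final factor `x b` from a
product of generators. -/
structure KoszulData (Q : GentleQuiverData.{u}) (k B : Type u) [Field k] [Ring B]
    [Algebra k B] where
  /-- vertex idempotents -/
  e : Q.V → B
  /-- arrows -/
  x : Q.E → B
  /-- stripping operators -/
  D : Q.E → B →ₗ[k] B
  e_mul_e_self : ∀ v, e v * e v = e v
  e_mul_e_of_ne : ∀ v w, v ≠ w → e v * e w = 0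
  sum_e : ∑ v, e v = 1
  x_mul_e : ∀ a, x a * e (Q.src a) = x a
  e_mul_x : ∀ a, e (Q.tgt a) * x a = x a
  x_mul_x : ∀ a b, Q.rel a b → x b * x a = 0
  D_one : ∀ b, D b 1 = 0
  D_mul_e : ∀ b y v, D b (y * e v) = if v = Q.src b then D b y else 0
  D_mul_x : ∀ b y a, D b (y * x a) =
    if a = b then y * e (Q.tgt a) - ∑ c, if Q.rel a c then D c y * x c else 0 else 0
  induction : ∀ P : B → Prop, P 1 → (∀ y z, P y → P z → P (y + z)) →
    (∀ (r : k) y, P y → P (r • y)) → (∀ y v, P y → P (y * e v)) →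
    (∀ y a, P y → P (y * x a)) → ∀ y, P y

namespace KoszulData

open TensorProduct
open scoped Classical

variable {k B T : Type u} [Field k] [Ring B] [Algebra k B] [AddCommGroup T] [Module k T]

section Operators

variable (k T)

/-- Right multiplication on the first factor of `B ⊗ T`. -/
noncomputable def rmul (y : B) : B ⊗[k] T →ₗ[B] B ⊗[k] T :=
  AlgebraTensorModule.map (LinearMap.toSpanSingleton B B y) LinearMap.id

variable {k T}

@[simp] theorem rmul_tmul (y z : B) (t : T) : rmul k T y (z ⊗ₜ t) = (z * y) ⊗ₜ t := by
  simp [rmul]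

theorem rmul_rmul (y z : B) (f : B ⊗[k] T) :
    rmul k T y (rmul k T z f) = rmul k T (z * y) f := by
  induction f with
  | zero => simp
  | add f g hf hg => simp_all
  | tmul w t => simp [mul_assoc]

theorem rmul_zero (f : B ⊗[k] T) : rmul k T 0 f = 0 := by
  induction f with
  | zero => simp
  | add f g hf hg => simp_all
  | tmul w t => simp

end Operators

variable {Q : GentleQuiverData.{u}} (𝒦 : KoszulData Q k B)

theorem e_mul_e (v w : Q.V) : 𝒦.e v * 𝒦.e w = if v = w then 𝒦.e v else 0 := by
  split_ifs with h
  · rw [← h, 𝒦.e_mul_e_self]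
  · exact 𝒦.e_mul_e_of_ne v w h

theorem D_mul_e_tgt (b : Q.E) (y : B) : 𝒦.D b y * 𝒦.e (Q.tgt b) = 𝒦.D b y := by
  refine 𝒦.induction (fun y => 𝒦.D b y * 𝒦.e (Q.tgt b) = 𝒦.D b y) ?_ ?_ ?_ ?_ ?_ y
  · simp [𝒦.D_one]
  · intro y z hy hz
    rw [map_add, add_mul, hy, hz]
  · intro r y hy
    rw [map_smul, smul_mul_assoc, hy]
  · intro y v hy
    rw [𝒦.D_mul_e]
    split_ifs <;> simp [hy]
  · intro y a hy
    rw [𝒦.D_mul_x]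
    split_ifs with hab
    · subst hab
      rw [sub_mul, mul_assoc, 𝒦.e_mul_e_self, Finset.sum_mul]
      congr 2 with c
      split_ifs with hc
      · rw [mul_assoc, Q.rel_comp _ _ hc, 𝒦.x_mul_e]
      · simp
    · simp

theorem D_D (b c : Q.E) (h : Q.rel b c) (y : B) : 𝒦.D c (𝒦.D b y) = 0 := by
  refine 𝒦.induction (fun y => ∀ b c, Q.rel b c → 𝒦.D c (𝒦.D b y) = 0) ?_ ?_ ?_ ?_ ?_ y b c h
  · simp [𝒦.D_one]
  · intro y z hy hz b c h
    simp [hy b c h, hz b c h]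
  · intro r y hy b c h
    simp [hy b c h]
  · intro y v hy b c h
    rw [𝒦.D_mul_e]
    split_ifs <;> simp [hy b c h]
  · intro y a hy b c h
    rw [𝒦.D_mul_x]
    split_ifs with hab
    · subst hab
      rw [map_sub, map_sum, Finset.sum_eq_single c, if_pos h, 𝒦.D_mul_e, 𝒦.D_mul_x, if_pos rfl,
        if_pos (Q.rel_comp _ _ h), D_mul_e_tgt, Finset.sum_eq_zero, sub_zero, sub_self]
      · intro d _
        split_ifs with hd
        · rw [hy c d hd, zero_mul]
        · rfl
      · intro d _ hd
        rw [if_neg fun h' => hd (Q.rel_right_unique _ _ _ h' h), map_zero]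
      · simp
    · simp

/-- The operator `D b` on the first factor of `B ⊗ T`. -/
noncomputable def strip (T : Type u) [AddCommGroup T] [Module k T] (b : Q.E) :
    B ⊗[k] T →ₗ[k] B ⊗[k] T := (𝒦.D b).rTensor T

@[simp] theorem strip_tmul (b : Q.E) (z : B) (t : T) :
    𝒦.strip T b (z ⊗ₜ t) = 𝒦.D b z ⊗ₜ t := rfl

theorem strip_strip (b c : Q.E) (h : Q.rel b c) (f : B ⊗[k] T) :
    𝒦.strip T c (𝒦.strip T b f) = 0 := by
  induction f with
  | zero => simp
  | add f g hf hg => simp_all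
  | tmul w t => simp [𝒦.D_D b c h]

theorem rmul_e_strip (b : Q.E) (f : B ⊗[k] T) :
    rmul k T (𝒦.e (Q.tgt b)) (𝒦.strip T b f) = 𝒦.strip T b f := by
  induction f with
  | zero => simp
  | add f g hf hg => simp_all
  | tmul w t => simp [D_mul_e_tgt]

theorem strip_rmul_e (b : Q.E) (v : Q.V) (f : B ⊗[k] T) :
    𝒦.strip T b (rmul k T (𝒦.e v) f) = if v = Q.src b then 𝒦.strip T b f else 0 := by
  induction f with
  | zero => simp
  | add f g hf hg =>
    rw [map_add, map_add, hf, hg, map_add]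
    split_ifs <;> simp
  | tmul w t =>
    rw [rmul_tmul, strip_tmul, 𝒦.D_mul_e]
    split_ifs <;> simp

theorem strip_rmul_x (b a : Q.E) (f : B ⊗[k] T) :
    𝒦.strip T b (rmul k T (𝒦.x a) f) = if a = b then rmul k T (𝒦.e (Q.tgt a)) f -
      ∑ c, if Q.rel a c then rmul k T (𝒦.x c) (𝒦.strip T c f) else 0 else 0 := by
  induction f with
  | zero => simp
  | add f g hf hg =>
    rw [map_add, map_add, hf, hg]
    split_ifs
    · rw [map_add, ← add_sub_add_comm, ← Finset.sum_add_distrib]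
      congr 2 with c
      split_ifs <;> simp
    · simp
  | tmul w t =>
    rw [rmul_tmul, strip_tmul, 𝒦.D_mul_x]
    split_ifs
    · rw [TensorProduct.sub_tmul, TensorProduct.sum_tmul, rmul_tmul]
      congr 2 with c
      split_ifs <;> simp
    · simp

section Action

variable [Module B T] [IsScalarTower k B T]

variable (k T) in
/-- The action of an algebra element on the second factor of `B ⊗ T`. -/
noncomputable def act (y : B) : B ⊗[k] T →ₗ[B] B ⊗[k] T :=
  AlgebraTensorModule.map LinearMap.id (Algebra.lsmul k k T y)

variable (k T) in
/-- The multiplication map `B ⊗ T → T`. -/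
noncomputable def mulMap : B ⊗[k] T →ₗ[B] T :=
  { TensorProduct.lift (Algebra.lsmul k k T : B →ₐ[k] Module.End k T).toLinearMap with
    map_smul' := fun r f => by
      induction f with
      | zero => simp
      | add f g hf hg => simp_all
      | tmul y t => simp [TensorProduct.smul_tmul'] }

@[simp] theorem act_tmul (y z : B) (t : T) : act k T y (z ⊗ₜ t) = z ⊗ₜ (y • t) := by
  simp [act]

@[simp] theorem mulMap_tmul (z : B) (t : T) : mulMap k T (z ⊗ₜ[k] t) = z • t := by
  simp [mulMap]

theorem act_act (y z : B) (f : B ⊗[k] T) :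
    act k T y (act k T z f) = act k T (y * z) f := by
  induction f with
  | zero => simp
  | add f g hf hg => simp_all
  | tmul w t => simp [mul_smul]

theorem rmul_act (y z : B) (f : B ⊗[k] T) :
    rmul k T y (act k T z f) = act k T z (rmul k T y f) := by
  induction f with
  | zero => simp
  | add f g hf hg => simp_all
  | tmul w t => simp

theorem mulMap_act (y : B) (f : B ⊗[k] T) :
    mulMap k T (act k T y f) = mulMap k T (rmul k T y f) := by
  induction f with
  | zero => simp
  | add f g hf hg => simp_all
  | tmul w t => simp [mul_smul]

theorem act_zero (f : B ⊗[k] T) : act k T 0 f = 0 := by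
  induction f with
  | zero => simp
  | add f g hf hg => simp_all
  | tmul w t => simp

theorem strip_act (b : Q.E) (y : B) (f : B ⊗[k] T) :
    𝒦.strip T b (act k T y f) = act k T y (𝒦.strip T b f) := by
  induction f with
  | zero => simp
  | add f g hf hg => simp_all
  | tmul w t => simp

end Action

end KoszulData

/-- A submodule which is a retract of a projective module is projective. -/
theorem Submodule.projective_of_retraction {B M : Type*} [Ring B] [AddCommGroup M] [Module B M]
    [Module.Projective B M] (S : Submodule B M) (p : M →ₗ[B] M) (hp : ∀ f, p f ∈ S)
    (hS : ∀ f ∈ S, p f = f) : Module.Projective B S :=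
  Module.Projective.of_split S.subtype (p.codRestrict S hp) <| by
    ext f
    exact hS f f.2

namespace KoszulData

open TensorProduct
open scoped Classical

variable {k B T : Type u} [Field k] [Ring B] [Algebra k B] [AddCommGroup T] [Module k T]
  {Q : GentleQuiverData.{u}} (𝒦 : KoszulData Q k B)

section Filtration

/-- Elements of `B ⊗ T` which are killed by any `n` stripping operators. -/
noncomputable def stripFiltration (T : Type u) [AddCommGroup T] [Module k T] : ℕ → Submodule k (B ⊗[k] T)
  | 0 => ⊥
  | n + 1 => ⨅ b, (stripFiltration T n).comap (𝒦.strip T b)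

theorem mem_stripFiltration_succ {n : ℕ} {f : B ⊗[k] T} :
    f ∈ 𝒦.stripFiltration T (n + 1) ↔ ∀ b, 𝒦.strip T b f ∈ 𝒦.stripFiltration T n := by
  simp [stripFiltration]

theorem stripFiltration_mono : Monotone (𝒦.stripFiltration T) := by
  refine monotone_nat_of_le_succ fun n => ?_
  induction n with
  | zero => exact bot_le
  | succ n ih =>
    intro f hf
    rw [mem_stripFiltration_succ] at hf ⊢
    exact fun b => ih (hf b)

theorem rmul_e_mem_stripFiltration {n : ℕ} {f : B ⊗[k] T} (v : Q.V)
    (hf : f ∈ 𝒦.stripFiltration T n) : rmul k T (𝒦.e v) f ∈ 𝒦.stripFiltration T n := by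
  cases n with
  | zero =>
    rw [(Submodule.mem_bot k).1 hf, map_zero]
    exact zero_mem _
  | succ n =>
    rw [mem_stripFiltration_succ] at hf ⊢
    intro b
    rw [strip_rmul_e]
    split_ifs
    · exact hf b
    · exact zero_mem _

theorem rmul_x_mem_stripFiltration {n : ℕ} {f : B ⊗[k] T} (a : Q.E)
    (hf : f ∈ 𝒦.stripFiltration T n) : rmul k T (𝒦.x a) f ∈ 𝒦.stripFiltration T (n + 1) := by
  induction n generalizing f a with
  | zero =>
    rw [(Submodule.mem_bot k).1 hf, map_zero]
    exact zero_mem _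
  | succ n ih =>
    have hf' := hf
    rw [mem_stripFiltration_succ] at hf ⊢
    intro b
    rw [strip_rmul_x]
    split_ifs
    · refine sub_mem (𝒦.rmul_e_mem_stripFiltration _ hf') (sum_mem fun c _ => ?_)
      split_ifs
      · exact ih c (hf c)
      · exact zero_mem _
    · exact zero_mem _

theorem exists_mem_stripFiltration (f : B ⊗[k] T) : ∃ n, f ∈ 𝒦.stripFiltration T n := by
  have hadd : ∀ f g : B ⊗[k] T, (∃ n, f ∈ 𝒦.stripFiltration T n) →
      (∃ n, g ∈ 𝒦.stripFiltration T n) → ∃ n, f + g ∈ 𝒦.stripFiltration T n := by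
    rintro f g ⟨m, hm⟩ ⟨n, hn⟩
    exact ⟨max m n, add_mem (𝒦.stripFiltration_mono (le_max_left m n) hm)
      (𝒦.stripFiltration_mono (le_max_right m n) hn)⟩
  induction f with
  | zero => exact ⟨0, zero_mem _⟩
  | add f g hf hg => exact hadd f g hf hg
  | tmul y t =>
    refine 𝒦.induction (fun y => ∃ n, y ⊗ₜ t ∈ 𝒦.stripFiltration T n) ?_ ?_ ?_ ?_ ?_ y
    · refine ⟨1, 𝒦.mem_stripFiltration_succ.2 fun b => ?_⟩
      simp [𝒦.D_one]
    · intro y z hy hz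
      rw [add_tmul]
      exact hadd _ _ hy hz
    · rintro r y ⟨n, hn⟩
      exact ⟨n, Submodule.smul_mem _ r hn⟩
    · rintro y v ⟨n, hn⟩
      exact ⟨n, by simpa using 𝒦.rmul_e_mem_stripFiltration v hn⟩
    · rintro y a ⟨n, hn⟩
      exact ⟨n + 1, by simpa using 𝒦.rmul_x_mem_stripFiltration a hn⟩

end Filtration

variable [Module B T] [IsScalarTower k B T]

theorem act_mem_stripFiltration {n : ℕ} {f : B ⊗[k] T} (y : B)
    (hf : f ∈ 𝒦.stripFiltration T n) : act k T y f ∈ 𝒦.stripFiltration T n := by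
  induction n generalizing f with
  | zero =>
    rw [(Submodule.mem_bot k).1 hf, map_zero]
    exact zero_mem _
  | succ n ih =>
    rw [mem_stripFiltration_succ] at hf ⊢
    intro b
    rw [strip_act]
    exact ih (hf b)

/-- A family with the fixed point property below vanishes, as stripping is locally nilpotent. -/
theorem eq_zero_of_eq_sum_strip (f : Q.E → B ⊗[k] T)
    (hf : ∀ b, f b = ∑ a, if Q.rel a b then 0 else act k T (𝒦.x a) (𝒦.strip T b (f a))) :
    f = 0 := by
  have key : ∀ n, (∀ b, f b ∈ 𝒦.stripFiltration T n) → f = 0 := by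
    intro n
    induction n with
    | zero => exact fun h => funext fun b => (Submodule.mem_bot k).1 (h b)
    | succ n ih =>
      refine fun h => ih fun b => ?_
      rw [hf b]
      refine sum_mem fun a _ => ?_
      split_ifs
      · exact zero_mem _
      · exact 𝒦.act_mem_stripFiltration _ (𝒦.mem_stripFiltration_succ.1 (h a) b)
  choose n hn using fun b => 𝒦.exists_mem_stripFiltration (f b)
  exact key (∑ b, n b) fun b => 𝒦.stripFiltration_mono
    (Finset.single_le_sum (fun _ _ => Nat.zero_le _) (Finset.mem_univ b)) (hn b)

section Degree

/-- The projection of `B ⊗ T` onto the direct sum of the `B e v ⊗ e v T`. -/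
noncomputable def vertexProj (T : Type u) [AddCommGroup T] [Module k T] [Module B T]
    [IsScalarTower k B T] : B ⊗[k] T →ₗ[B] B ⊗[k] T :=
  ∑ v, rmul k T (𝒦.e v) ∘ₗ act k T (𝒦.e v)

theorem vertexProj_apply (f : B ⊗[k] T) :
    𝒦.vertexProj T f = ∑ v, rmul k T (𝒦.e v) (act k T (𝒦.e v) f) := by
  simp [vertexProj]

theorem vertexProj_rmul_act (v w : Q.V) (f : B ⊗[k] T) :
    𝒦.vertexProj T (rmul k T (𝒦.e v) (act k T (𝒦.e w) f)) =
      if v = w then rmul k T (𝒦.e v) (act k T (𝒦.e w) f) else 0 := by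
  rw [vertexProj_apply, Finset.sum_eq_single v]
  · rw [← rmul_act, rmul_rmul, e_mul_e, if_pos rfl, act_act, e_mul_e]
    split_ifs with h
    · rw [h]
    · rw [act_zero, map_zero]
  · intro u _ hu
    rw [← rmul_act, rmul_rmul, e_mul_e, if_neg (Ne.symm hu), rmul_zero]
  · simp

theorem vertexProj_eq_self {v : Q.V} {f : B ⊗[k] T} (h : rmul k T (𝒦.e v) f = f)
    (h' : act k T (𝒦.e v) f = f) : 𝒦.vertexProj T f = f := by
  have := 𝒦.vertexProj_rmul_act v v f
  rwa [h', h, if_pos rfl] at this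

theorem vertexProj_vertexProj (f : B ⊗[k] T) :
    𝒦.vertexProj T (𝒦.vertexProj T f) = 𝒦.vertexProj T f := by
  conv_lhs => rw [𝒦.vertexProj_apply f, map_sum]
  simp only [vertexProj_rmul_act, if_pos]
  rw [vertexProj_apply]

theorem vertexProj_rmul_e (v : Q.V) (f : B ⊗[k] T) :
    𝒦.vertexProj T (rmul k T (𝒦.e v) f) = 𝒦.vertexProj T (act k T (𝒦.e v) f) := by
  simp only [vertexProj_apply]
  refine Finset.sum_congr rfl fun w _ => ?_
  rw [← rmul_act, rmul_rmul, act_act, e_mul_e, e_mul_e]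
  by_cases h : v = w
  · rw [if_pos h, if_pos h.symm, h]
  · rw [if_neg h, if_neg (Ne.symm h), rmul_zero, act_zero, map_zero]

theorem e_mul_x_eq (v : Q.V) (a : Q.E) : 𝒦.e v * 𝒦.x a = if v = Q.tgt a then 𝒦.x a else 0 := by
  rw [← 𝒦.e_mul_x a, ← mul_assoc, e_mul_e]
  split_ifs with h
  · rw [h]
  · exact zero_mul _

theorem x_mul_e_eq (v : Q.V) (a : Q.E) : 𝒦.x a * 𝒦.e v = if Q.src a = v then 𝒦.x a else 0 := by
  rw [← 𝒦.x_mul_e a, mul_assoc, e_mul_e]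
  split_ifs with h
  · rfl
  · exact mul_zero _

theorem vertexProj_rmul_x (a : Q.E) (f : B ⊗[k] T) :
    𝒦.vertexProj T (rmul k T (𝒦.x a) f) =
      rmul k T (𝒦.x a) (rmul k T (𝒦.e (Q.tgt a)) (act k T (𝒦.e (Q.src a)) f)) := by
  rw [vertexProj_apply, Finset.sum_eq_single (Q.src a)]
  · rw [← rmul_act, rmul_rmul, x_mul_e_eq, if_pos rfl, rmul_rmul, e_mul_x, rmul_act]
  · intro v _ hv
    rw [← rmul_act, rmul_rmul, x_mul_e_eq, if_neg (Ne.symm hv), rmul_zero]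
  · simp

theorem vertexProj_act_x (a : Q.E) (f : B ⊗[k] T) :
    𝒦.vertexProj T (act k T (𝒦.x a) f) =
      act k T (𝒦.x a) (rmul k T (𝒦.e (Q.tgt a)) (act k T (𝒦.e (Q.src a)) f)) := by
  rw [vertexProj_apply, Finset.sum_eq_single (Q.tgt a)]
  · rw [act_act, e_mul_x_eq, if_pos rfl, ← rmul_act, act_act, x_mul_e, rmul_act]
  · intro v _ hv
    rw [act_act, e_mul_x_eq, if_neg hv, act_zero, map_zero]
  · simp

/-- The degree zero term of the Koszul resolution of `T`. -/
noncomputable def koszulZero (T : Type u) [AddCommGroup T] [Module k T] [Module B T]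
    [IsScalarTower k B T] : Submodule B (B ⊗[k] T) :=
  LinearMap.eqLocus (𝒦.vertexProj T) LinearMap.id

theorem mem_koszulZero {f : B ⊗[k] T} : f ∈ 𝒦.koszulZero T ↔ 𝒦.vertexProj T f = f := Iff.rfl

/-- The term of degree `n + 1` of the Koszul resolution of `T`: families of elements of
`B e (tgt b) ⊗ e (src a) T` indexed by the relation chains of length `n` from `a` to `b`. -/
noncomputable def koszul (T : Type u) [AddCommGroup T] [Module k T] [Module B T]
    [IsScalarTower k B T] (n : ℕ) : Submodule B (Q.E → Q.E → B ⊗[k] T) where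
  carrier := {f | ∀ a b, rmul k T (𝒦.e (Q.tgt b)) (f a b) = f a b ∧
    act k T (𝒦.e (Q.src a)) (f a b) = f a b ∧ (¬ Q.Chain n a b → f a b = 0)}
  zero_mem' := by simp
  add_mem' := by
    intro f g hf hg a b
    obtain ⟨h₁, h₂, h₃⟩ := hf a b
    obtain ⟨h₁', h₂', h₃'⟩ := hg a b
    refine ⟨by simp [h₁, h₁'], by simp [h₂, h₂'], fun h => by simp [h₃ h, h₃' h]⟩
  smul_mem' := by
    intro r f hf a b
    obtain ⟨h₁, h₂, h₃⟩ := hf a b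
    refine ⟨by simp [h₁], by simp [h₂], fun h => by simp [h₃ h]⟩

variable {𝒦} in
theorem koszul_rmul {n : ℕ} {f : Q.E → Q.E → B ⊗[k] T} (hf : f ∈ 𝒦.koszul T n) (a b : Q.E) :
    rmul k T (𝒦.e (Q.tgt b)) (f a b) = f a b := (hf a b).1

variable {𝒦} in
theorem koszul_act {n : ℕ} {f : Q.E → Q.E → B ⊗[k] T} (hf : f ∈ 𝒦.koszul T n) (a b : Q.E) :
    act k T (𝒦.e (Q.src a)) (f a b) = f a b := (hf a b).2.1

variable {𝒦} in
theorem koszul_eq_zero {n : ℕ} {f : Q.E → Q.E → B ⊗[k] T} (hf : f ∈ 𝒦.koszul T n) {a b : Q.E}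
    (h : ¬ Q.Chain n a b) : f a b = 0 := (hf a b).2.2 h

theorem projective_koszulZero : Module.Projective B (𝒦.koszulZero T) :=
  Submodule.projective_of_retraction _ (𝒦.vertexProj T) 𝒦.vertexProj_vertexProj fun _ h => h

theorem projective_koszul (n : ℕ) : Module.Projective B (𝒦.koszul T n) := by
  refine Submodule.projective_of_retraction _
    (LinearMap.pi fun a => LinearMap.pi fun b => if Q.Chain n a b then
      rmul k T (𝒦.e (Q.tgt b)) ∘ₗ act k T (𝒦.e (Q.src a)) ∘ₗ LinearMap.proj b ∘ₗ
        LinearMap.proj a else 0) (fun f a b => ?_) fun f hf => ?_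
  · simp only [LinearMap.pi_apply]
    split_ifs with h
    · simp [rmul_rmul, ← rmul_act, act_act, e_mul_e, h]
    · simp
  · ext a b
    simp only [LinearMap.pi_apply]
    split_ifs with h
    · simp [koszul_act hf, koszul_rmul hf]
    · simp [koszul_eq_zero hf h]

end Degree

end KoszulData

namespace KoszulData

open TensorProduct
open scoped Classical

variable {k B T : Type u} [Field k] [Ring B] [Algebra k B] [AddCommGroup T] [Module k T]
  {Q : GentleQuiverData.{u}} (𝒦 : KoszulData Q k B)

section Differential

/-- The part of the Koszul differential acting on `B`. -/
noncomputable def dRight : (Q.E → Q.E → B ⊗[k] T) →ₗ[B] (Q.E → Q.E → B ⊗[k] T) :=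
  LinearMap.pi fun a => LinearMap.pi fun b => ∑ c, if Q.rel b c then
    rmul k T (𝒦.x c) ∘ₗ LinearMap.proj c ∘ₗ LinearMap.proj a else 0

/-- The contraction of `dRight`. -/
noncomputable def homotopy : (Q.E → Q.E → B ⊗[k] T) →ₗ[k] (Q.E → Q.E → B ⊗[k] T) :=
  LinearMap.pi fun a => LinearMap.pi fun b => ∑ c, if Q.rel c b then
    𝒦.strip T b ∘ₗ LinearMap.proj c ∘ₗ LinearMap.proj a else 0

theorem dRight_apply (f : Q.E → Q.E → B ⊗[k] T) (a b : Q.E) :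
    𝒦.dRight f a b = ∑ c, if Q.rel b c then rmul k T (𝒦.x c) (f a c) else 0 := by
  simp only [dRight, LinearMap.pi_apply, LinearMap.sum_apply]
  refine Finset.sum_congr rfl fun c _ => ?_
  split_ifs <;> rfl

theorem homotopy_apply (f : Q.E → Q.E → B ⊗[k] T) (a b : Q.E) :
    𝒦.homotopy f a b = ∑ c, if Q.rel c b then 𝒦.strip T b (f a c) else 0 := by
  simp only [homotopy, LinearMap.pi_apply, LinearMap.sum_apply]
  refine Finset.sum_congr rfl fun c _ => ?_
  split_ifs <;> rfl

theorem dRight_of_rel (f : Q.E → Q.E → B ⊗[k] T) (a : Q.E) {b c : Q.E} (h : Q.rel b c) :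
    𝒦.dRight f a b = rmul k T (𝒦.x c) (f a c) := by
  rw [dRight_apply, Finset.sum_eq_single c, if_pos h]
  · exact fun d _ hd => if_neg fun h' => hd (Q.rel_right_unique _ _ _ h' h)
  · simp

theorem homotopy_of_rel (f : Q.E → Q.E → B ⊗[k] T) (a : Q.E) {b c : Q.E} (h : Q.rel c b) :
    𝒦.homotopy f a b = 𝒦.strip T b (f a c) := by
  rw [homotopy_apply, Finset.sum_eq_single c, if_pos h]
  · exact fun d _ hd => if_neg fun h' => hd (Q.rel_left_unique _ _ _ h' h)
  · simp

theorem dRight_of_not_rel (f : Q.E → Q.E → B ⊗[k] T) (a : Q.E) {b : Q.E}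
    (h : ∀ c, ¬ Q.rel b c) : 𝒦.dRight f a b = 0 := by
  simp [dRight_apply, h]

theorem homotopy_of_not_rel (f : Q.E → Q.E → B ⊗[k] T) (a : Q.E) {b : Q.E}
    (h : ∀ c, ¬ Q.rel c b) : 𝒦.homotopy f a b = 0 := by
  simp [homotopy_apply, h]

theorem dRight_dRight (f : Q.E → Q.E → B ⊗[k] T) : 𝒦.dRight (𝒦.dRight f) = 0 := by
  ext a b
  by_cases h : ∃ c, Q.rel b c
  · obtain ⟨c, hc⟩ := h
    rw [𝒦.dRight_of_rel _ a hc]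
    by_cases h' : ∃ d, Q.rel c d
    · obtain ⟨d, hd⟩ := h'
      rw [𝒦.dRight_of_rel _ a hd, rmul_rmul, 𝒦.x_mul_x _ _ hd, rmul_zero]
      rfl
    · rw [𝒦.dRight_of_not_rel f a (not_exists.1 h'), map_zero]
      rfl
  · exact 𝒦.dRight_of_not_rel _ a (not_exists.1 h)

theorem dRight_homotopy_apply (f : Q.E → Q.E → B ⊗[k] T) (a b : Q.E) :
    𝒦.dRight (𝒦.homotopy f) a b =
      ∑ c, if Q.rel b c then rmul k T (𝒦.x c) (𝒦.strip T c (f a b)) else 0 := by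
  rw [dRight_apply]
  refine Finset.sum_congr rfl fun c _ => ?_
  split_ifs with h
  · rw [𝒦.homotopy_of_rel f a h]
  · rfl

variable [Module B T] [IsScalarTower k B T]

/-- The part of the Koszul differential acting on `T`. -/
noncomputable def dLeft : (Q.E → Q.E → B ⊗[k] T) →ₗ[B] (Q.E → Q.E → B ⊗[k] T) :=
  LinearMap.pi fun a => LinearMap.pi fun b => ∑ c, if Q.rel c a then
    act k T (𝒦.x c) ∘ₗ LinearMap.proj b ∘ₗ LinearMap.proj c else 0

theorem dLeft_apply (f : Q.E → Q.E → B ⊗[k] T) (a b : Q.E) :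
    𝒦.dLeft f a b = ∑ c, if Q.rel c a then act k T (𝒦.x c) (f c b) else 0 := by
  simp only [dLeft, LinearMap.pi_apply, LinearMap.sum_apply]
  refine Finset.sum_congr rfl fun c _ => ?_
  split_ifs <;> rfl

theorem dLeft_of_rel (f : Q.E → Q.E → B ⊗[k] T) {a c : Q.E} (h : Q.rel c a) (b : Q.E) :
    𝒦.dLeft f a b = act k T (𝒦.x c) (f c b) := by
  rw [dLeft_apply, Finset.sum_eq_single c, if_pos h]
  · exact fun d _ hd => if_neg fun h' => hd (Q.rel_left_unique _ _ _ h' h)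
  · simp

theorem dLeft_of_not_rel (f : Q.E → Q.E → B ⊗[k] T) {a : Q.E} (h : ∀ c, ¬ Q.rel c a) (b : Q.E) :
    𝒦.dLeft f a b = 0 := by
  simp [dLeft_apply, h]

theorem dLeft_mem {n : ℕ} {f : Q.E → Q.E → B ⊗[k] T} (hf : f ∈ 𝒦.koszul T (n + 1)) :
    𝒦.dLeft f ∈ 𝒦.koszul T n := by
  intro a b
  by_cases h : ∃ c, Q.rel c a
  · obtain ⟨c, hc⟩ := h
    rw [𝒦.dLeft_of_rel f hc]
    refine ⟨?_, ?_, fun h => ?_⟩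
    · rw [rmul_act, koszul_rmul hf]
    · rw [act_act, ← Q.rel_comp _ _ hc, e_mul_x]
    · rw [koszul_eq_zero hf fun h' => h (h'.tail hc), map_zero]
  · simp [𝒦.dLeft_of_not_rel f (not_exists.1 h)]

theorem dRight_mem {n : ℕ} {f : Q.E → Q.E → B ⊗[k] T} (hf : f ∈ 𝒦.koszul T (n + 1)) :
    𝒦.dRight f ∈ 𝒦.koszul T n := by
  intro a b
  by_cases h : ∃ c, Q.rel b c
  · obtain ⟨c, hc⟩ := h
    rw [𝒦.dRight_of_rel f a hc]
    refine ⟨?_, ?_, fun h => ?_⟩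
    · rw [rmul_rmul, Q.rel_comp _ _ hc, x_mul_e]
    · rw [← rmul_act, koszul_act hf]
    · rw [koszul_eq_zero hf fun h' => h (h'.dropLast hc), map_zero]
  · simp [𝒦.dRight_of_not_rel f a (not_exists.1 h)]

theorem homotopy_mem {n : ℕ} {f : Q.E → Q.E → B ⊗[k] T} (hf : f ∈ 𝒦.koszul T n) :
    𝒦.homotopy f ∈ 𝒦.koszul T (n + 1) := by
  intro a b
  by_cases h : ∃ c, Q.rel c b
  · obtain ⟨c, hc⟩ := h
    rw [𝒦.homotopy_of_rel f a hc]
    refine ⟨?_, ?_, fun h => ?_⟩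
    · rw [rmul_e_strip]
    · rw [← strip_act, koszul_act hf]
    · rw [koszul_eq_zero hf fun h' => h ⟨c, h', hc⟩, map_zero]
  · simp [𝒦.homotopy_of_not_rel f a (not_exists.1 h)]

theorem dLeft_dLeft (f : Q.E → Q.E → B ⊗[k] T) : 𝒦.dLeft (𝒦.dLeft f) = 0 := by
  ext a b
  by_cases h : ∃ c, Q.rel c a
  · obtain ⟨c, hc⟩ := h
    rw [𝒦.dLeft_of_rel _ hc]
    by_cases h' : ∃ d, Q.rel d c
    · obtain ⟨d, hd⟩ := h'
      rw [𝒦.dLeft_of_rel _ hd, act_act, 𝒦.x_mul_x _ _ hd, act_zero]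
      rfl
    · rw [𝒦.dLeft_of_not_rel f (not_exists.1 h'), map_zero]
      rfl
  · exact 𝒦.dLeft_of_not_rel _ (not_exists.1 h) b

theorem dLeft_dRight (f : Q.E → Q.E → B ⊗[k] T) :
    𝒦.dLeft (𝒦.dRight f) = 𝒦.dRight (𝒦.dLeft f) := by
  ext a b
  by_cases h : ∃ c, Q.rel b c
  · obtain ⟨c, hc⟩ := h
    rw [𝒦.dRight_of_rel _ a hc, dLeft_apply, dLeft_apply, map_sum]
    refine Finset.sum_congr rfl fun d _ => ?_
    rw [𝒦.dRight_of_rel _ d hc, ← rmul_act]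
    split_ifs <;> simp
  · rw [𝒦.dRight_of_not_rel _ a (not_exists.1 h), dLeft_apply]
    simp [𝒦.dRight_of_not_rel f _ (not_exists.1 h)]

theorem dLeft_homotopy (f : Q.E → Q.E → B ⊗[k] T) :
    𝒦.dLeft (𝒦.homotopy f) = 𝒦.homotopy (𝒦.dLeft f) := by
  ext a b
  by_cases h : ∃ c, Q.rel c b
  · obtain ⟨c, hc⟩ := h
    rw [𝒦.homotopy_of_rel _ a hc, dLeft_apply, dLeft_apply, map_sum]
    refine Finset.sum_congr rfl fun d _ => ?_
    rw [𝒦.homotopy_of_rel _ d hc, ← strip_act]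
    split_ifs <;> simp
  · rw [𝒦.homotopy_of_not_rel _ a (not_exists.1 h), dLeft_apply]
    simp [𝒦.homotopy_of_not_rel f _ (not_exists.1 h)]

theorem dRight_homotopy_add {n : ℕ} {f : Q.E → Q.E → B ⊗[k] T}
    (hf : f ∈ 𝒦.koszul T (n + 1)) :
    𝒦.dRight (𝒦.homotopy f) + 𝒦.homotopy (𝒦.dRight f) = f := by
  ext a b
  by_cases h : ∃ c, Q.rel c b
  · obtain ⟨c, hc⟩ := h
    rw [Pi.add_apply, Pi.add_apply, dRight_homotopy_apply, 𝒦.homotopy_of_rel _ a hc,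
      𝒦.dRight_of_rel f a hc, strip_rmul_x, if_pos rfl, koszul_rmul hf, add_sub_cancel]
  · have h0 : f a b = 0 := koszul_eq_zero hf fun ⟨c, _, hc⟩ => h ⟨c, hc⟩
    rw [Pi.add_apply, Pi.add_apply, dRight_homotopy_apply,
      𝒦.homotopy_of_not_rel _ a (not_exists.1 h), h0]
    simp

theorem smul_mem_koszul {n : ℕ} {f : Q.E → Q.E → B ⊗[k] T} (s : ℤˣ) (hf : f ∈ 𝒦.koszul T n) :
    s • f ∈ 𝒦.koszul T n := by
  rw [Units.smul_def]
  exact zsmul_mem hf _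

/-- The Koszul differential in positive degrees. -/
noncomputable def koszulD (T : Type u) [AddCommGroup T] [Module k T] [Module B T]
    [IsScalarTower k B T] (n : ℕ) : 𝒦.koszul T (n + 1) →ₗ[B] 𝒦.koszul T n :=
  LinearMap.restrict (𝒦.dLeft + ((-1 : ℤˣ) ^ n) • 𝒦.dRight) fun _ hf =>
    add_mem (𝒦.dLeft_mem hf) (𝒦.smul_mem_koszul _ (𝒦.dRight_mem hf))

theorem coe_koszulD (n : ℕ) (f : 𝒦.koszul T (n + 1)) :
    (𝒦.koszulD T n f : Q.E → Q.E → B ⊗[k] T) = 𝒦.dLeft f + ((-1 : ℤˣ) ^ n) • 𝒦.dRight f := rfl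

theorem exact_koszulD (n : ℕ) : Function.Exact (𝒦.koszulD T (n + 1)) (𝒦.koszulD T n) := by
  set s : ℤˣ := (-1) ^ n with hs
  have hs' : (-1 : ℤˣ) ^ (n + 1) = -s := by rw [pow_succ, mul_neg_one]
  have hss : s * s = 1 := Int.units_mul_self s
  intro f
  constructor
  · intro h
    have h' : 𝒦.dLeft f + s • 𝒦.dRight f = (0 : Q.E → Q.E → B ⊗[k] T) :=
      congrArg Subtype.val h
    refine ⟨⟨-s • 𝒦.homotopy f, 𝒦.smul_mem_koszul _ (𝒦.homotopy_mem f.2)⟩, Subtype.ext ?_⟩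
    have h₁ := 𝒦.dRight_homotopy_add f.2
    have h₂ := congrArg 𝒦.homotopy h'
    rw [map_add, ← dLeft_homotopy, map_zero, Units.smul_def, map_zsmul, ← Units.smul_def] at h₂
    change 𝒦.dLeft (-s • 𝒦.homotopy f) +
      (-1 : ℤˣ) ^ (n + 1) • 𝒦.dRight (-s • 𝒦.homotopy f) = (f : Q.E → Q.E → B ⊗[k] T)
    rw [hs', Units.smul_def, map_zsmul, map_zsmul, ← Units.smul_def,
      ← Units.smul_def, smul_smul, neg_mul_neg, hss, one_smul, eq_neg_of_add_eq_zero_left h₂,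
      smul_neg, Units.neg_smul, neg_neg, smul_smul, hss, one_smul, add_comm]
    exact h₁
  · rintro ⟨g, rfl⟩
    refine Subtype.ext ?_
    rw [coe_koszulD, coe_koszulD, hs', ← hs, map_add, map_add, dLeft_dLeft, Units.smul_def,
      Units.smul_def, map_zsmul, map_zsmul, dRight_dRight, dLeft_dRight]
    simp

end Differential

end KoszulData

namespace KoszulData

open TensorProduct
open scoped Classical

variable {k B T : Type u} [Field k] [Ring B] [Algebra k B] [AddCommGroup T] [Module k T]
  {Q : GentleQuiverData.{u}} (𝒦 : KoszulData Q k B) [Module B T] [IsScalarTower k B T]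

section Augmentation

theorem vertexProj_rmul_x_of_mem {n : ℕ} {f : Q.E → Q.E → B ⊗[k] T} (hf : f ∈ 𝒦.koszul T n)
    (a : Q.E) : 𝒦.vertexProj T (rmul k T (𝒦.x a) (f a a)) = rmul k T (𝒦.x a) (f a a) := by
  rw [vertexProj_rmul_x, koszul_act hf, koszul_rmul hf]

theorem vertexProj_act_x_of_mem {n : ℕ} {f : Q.E → Q.E → B ⊗[k] T} (hf : f ∈ 𝒦.koszul T n)
    (a : Q.E) : 𝒦.vertexProj T (act k T (𝒦.x a) (f a a)) = act k T (𝒦.x a) (f a a) := by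
  rw [vertexProj_act_x, koszul_act hf, koszul_rmul hf]

/-- The map underlying the lowest differential of the Koszul resolution. -/
noncomputable def diagMap : (Q.E → Q.E → B ⊗[k] T) →ₗ[B] B ⊗[k] T :=
  ∑ a, (act k T (𝒦.x a) - rmul k T (𝒦.x a)) ∘ₗ LinearMap.proj a ∘ₗ LinearMap.proj a

theorem diagMap_apply (f : Q.E → Q.E → B ⊗[k] T) :
    𝒦.diagMap f = ∑ a, (act k T (𝒦.x a) (f a a) - rmul k T (𝒦.x a) (f a a)) := by
  simp [diagMap]

/-- The lowest differential of the Koszul resolution. -/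
noncomputable def koszulD₀ (T : Type u) [AddCommGroup T] [Module k T] [Module B T]
    [IsScalarTower k B T] : 𝒦.koszul T 0 →ₗ[B] 𝒦.koszulZero T :=
  LinearMap.restrict 𝒦.diagMap fun f hf => by
    rw [mem_koszulZero, diagMap_apply, map_sum]
    exact Finset.sum_congr rfl fun a _ => by
      rw [map_sub, 𝒦.vertexProj_rmul_x_of_mem hf, 𝒦.vertexProj_act_x_of_mem hf]

theorem coe_koszulD₀ (f : 𝒦.koszul T 0) :
    (𝒦.koszulD₀ T f : B ⊗[k] T) = 𝒦.diagMap (f : Q.E → Q.E → B ⊗[k] T) := rfl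

theorem diagMap_dLeft_add_dRight (f : Q.E → Q.E → B ⊗[k] T) :
    𝒦.diagMap (𝒦.dLeft f + 𝒦.dRight f) = 0 := by
  have h₁ : ∀ a, act k T (𝒦.x a) (𝒦.dLeft f a a) = 0 := fun a => by
    rw [dLeft_apply, map_sum]
    refine Finset.sum_eq_zero fun c _ => ?_
    split_ifs with h
    · rw [act_act, 𝒦.x_mul_x _ _ h, act_zero]
    · rw [map_zero]
  have h₂ : ∀ a, rmul k T (𝒦.x a) (𝒦.dRight f a a) = 0 := fun a => by
    rw [dRight_apply, map_sum]
    refine Finset.sum_eq_zero fun c _ => ?_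
    split_ifs with h
    · rw [rmul_rmul, 𝒦.x_mul_x _ _ h, rmul_zero]
    · rw [map_zero]
  rw [diagMap_apply]
  simp only [Pi.add_apply, map_add, h₁, h₂, zero_add, add_zero]
  rw [Finset.sum_sub_distrib, sub_eq_zero]
  simp only [dLeft_apply, dRight_apply, map_sum]
  rw [Finset.sum_comm]
  refine Finset.sum_congr rfl fun a _ => Finset.sum_congr rfl fun b _ => ?_
  split_ifs
  · rw [rmul_act]
  · simp

theorem exists_koszulD₀_eq (f : B ⊗[k] T) : ∃ g, (𝒦.koszulD₀ T g : B ⊗[k] T) =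
    𝒦.vertexProj T f - 𝒦.vertexProj T (1 ⊗ₜ mulMap k T f) := by
  have key : ∀ (f : B ⊗[k] T) (a : Q.E), ∃ g, (𝒦.koszulD₀ T g : B ⊗[k] T) =
      𝒦.vertexProj T (rmul k T (𝒦.x a) f) - 𝒦.vertexProj T (act k T (𝒦.x a) f) := by
    intro f a
    set h := rmul k T (𝒦.e (Q.tgt a)) (act k T (𝒦.e (Q.src a)) f) with hh
    have hmem : (Pi.single a (Pi.single a (-h)) : Q.E → Q.E → B ⊗[k] T) ∈ 𝒦.koszul T 0 := by
      intro b c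
      by_cases hb : b = a
      · subst hb
        rw [Pi.single_eq_same]
        by_cases hc : c = b
        · subst hc
          rw [Pi.single_eq_same]
          refine ⟨?_, ?_, fun h => absurd rfl h⟩
          · rw [map_neg, hh, rmul_rmul, 𝒦.e_mul_e_self]
          · rw [map_neg, hh, ← rmul_act, act_act, 𝒦.e_mul_e_self]
        · simp [Pi.single_eq_of_ne hc]
      · simp [Pi.single_eq_of_ne hb]
    refine ⟨⟨_, hmem⟩, ?_⟩
    rw [coe_koszulD₀, vertexProj_rmul_x, vertexProj_act_x, ← hh]
    change 𝒦.diagMap (Pi.single a (Pi.single a (-h))) = _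
    rw [diagMap_apply, Finset.sum_eq_single a]
    · simp only [Pi.single_eq_same, map_neg]
      abel
    · intro b _ hb
      simp [Pi.single_eq_of_ne hb]
    · simp
  induction f with
  | zero => exact ⟨0, by simp⟩
  | add f g hf hg =>
    obtain ⟨f', hf⟩ := hf
    obtain ⟨g', hg⟩ := hg
    refine ⟨f' + g', ?_⟩
    rw [map_add, Submodule.coe_add, hf, hg, map_add, map_add, tmul_add, map_add]
    abel
  | tmul y t =>
    refine 𝒦.induction (fun y => ∀ t : T, ∃ g, (𝒦.koszulD₀ T g : B ⊗[k] T) =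
      𝒦.vertexProj T (y ⊗ₜ t) - 𝒦.vertexProj T (1 ⊗ₜ mulMap k T (y ⊗ₜ[k] t)))
      ?_ ?_ ?_ ?_ ?_ y t
    · exact fun t => ⟨0, by simp⟩
    · intro y z hy hz t
      obtain ⟨f', hf⟩ := hy t
      obtain ⟨g', hg⟩ := hz t
      refine ⟨f' + g', ?_⟩
      rw [map_add, Submodule.coe_add, hf, hg, add_tmul, map_add, map_add, tmul_add, map_add]
      abel
    · intro r y hy t
      obtain ⟨g, hg⟩ := hy (r • t)
      exact ⟨g, by rw [hg, smul_tmul]⟩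
    · intro y v hy t
      obtain ⟨g, hg⟩ := hy (𝒦.e v • t)
      refine ⟨g, ?_⟩
      have := 𝒦.vertexProj_rmul_e v (y ⊗ₜ t)
      rw [rmul_tmul, act_tmul] at this
      rw [hg, this, mulMap_tmul, mulMap_tmul, mul_smul]
    · intro y a hy t
      obtain ⟨g, hg⟩ := hy (𝒦.x a • t)
      obtain ⟨g', hg'⟩ := key (y ⊗ₜ t) a
      refine ⟨g' + g, ?_⟩
      rw [map_add, Submodule.coe_add, hg, hg', rmul_tmul, act_tmul, mulMap_tmul, mulMap_tmul,
        mul_smul, sub_add_sub_cancel]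

/-- The augmentation of the Koszul resolution. -/
noncomputable def koszulAug (T : Type u) [AddCommGroup T] [Module k T] [Module B T]
    [IsScalarTower k B T] : 𝒦.koszulZero T →ₗ[B] T :=
  mulMap k T ∘ₗ (𝒦.koszulZero T).subtype

theorem koszulAug_surjective : Function.Surjective (𝒦.koszulAug T) := by
  intro t
  refine ⟨⟨𝒦.vertexProj T (1 ⊗ₜ t), 𝒦.vertexProj_vertexProj _⟩, ?_⟩
  change mulMap k T (𝒦.vertexProj T (1 ⊗ₜ t)) = t
  simp [vertexProj_apply, ← mul_smul, 𝒦.e_mul_e_self, ← Finset.sum_smul, 𝒦.sum_e]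

theorem exact_koszulAug : Function.Exact (𝒦.koszulD₀ T) (𝒦.koszulAug T) := by
  intro f
  constructor
  · intro h
    have h : mulMap k T (f : B ⊗[k] T) = 0 := h
    obtain ⟨g, hg⟩ := 𝒦.exists_koszulD₀_eq (f : B ⊗[k] T)
    rw [h, tmul_zero, map_zero, sub_zero] at hg
    exact ⟨g, Subtype.ext (hg.trans f.2)⟩
  · rintro ⟨g, rfl⟩
    change mulMap k T (𝒦.diagMap (g : Q.E → Q.E → B ⊗[k] T)) = 0
    rw [diagMap_apply, map_sum]
    exact Finset.sum_eq_zero fun a _ => by rw [map_sub, mulMap_act, sub_self]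

theorem eq_dLeft_add_dRight_homotopy {f : Q.E → Q.E → B ⊗[k] T} (hf : f ∈ 𝒦.koszul T 0)
    (h : 𝒦.diagMap f = 0) : 𝒦.dLeft (𝒦.homotopy f) + 𝒦.dRight (𝒦.homotopy f) = f := by
  have haux : ∀ g ∈ 𝒦.koszul T 0, 𝒦.diagMap g = 0 → ∀ b,
      (g - (𝒦.dLeft (𝒦.homotopy g) + 𝒦.dRight (𝒦.homotopy g))) b b =
        ∑ a, if Q.rel a b then 0 else act k T (𝒦.x a) (𝒦.strip T b (g a a)) := by
    intro g hg h b
    have h' := congrArg (𝒦.strip T b) h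
    rw [diagMap_apply, map_zero, map_sum] at h'
    simp only [map_sub, strip_act, strip_rmul_x] at h'
    rw [Finset.sum_sub_distrib, Finset.sum_ite_eq' Finset.univ b, if_pos (Finset.mem_univ b),
      koszul_rmul hg, ← dRight_homotopy_apply, sub_eq_zero] at h'
    have h'' : 𝒦.dLeft (𝒦.homotopy g) b b =
        ∑ a, if Q.rel a b then act k T (𝒦.x a) (𝒦.strip T b (g a a)) else 0 := by
      rw [dLeft_apply]
      refine Finset.sum_congr rfl fun a _ => ?_
      split_ifs with hr
      · rw [𝒦.homotopy_of_rel _ _ hr]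
      · rfl
    simp only [Pi.sub_apply, Pi.add_apply]
    rw [h'', add_comm, ← sub_sub, ← h', ← Finset.sum_sub_distrib]
    refine Finset.sum_congr rfl fun a _ => ?_
    split_ifs <;> simp
  set g := f - (𝒦.dLeft (𝒦.homotopy f) + 𝒦.dRight (𝒦.homotopy f)) with hg
  have hmem : g ∈ 𝒦.koszul T 0 := sub_mem hf
    (add_mem (𝒦.dLeft_mem (𝒦.homotopy_mem hf)) (𝒦.dRight_mem (𝒦.homotopy_mem hf)))
  have hdiag : 𝒦.diagMap g = 0 := by
    rw [hg, map_sub, h, diagMap_dLeft_add_dRight, sub_self]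
  have hhom : 𝒦.homotopy g = 0 := by
    ext a b
    by_cases hb : ∃ c, Q.rel c b
    · obtain ⟨c, hc⟩ := hb
      rw [𝒦.homotopy_of_rel _ a hc]
      by_cases hac : a = c
      · subst hac
        rw [hg, haux f hf h, map_sum]
        refine Finset.sum_eq_zero fun d _ => ?_
        split_ifs
        · rw [map_zero]
        · rw [strip_act, 𝒦.strip_strip _ _ hc, map_zero]
      · rw [koszul_eq_zero hmem hac, map_zero]
        rfl
    · exact 𝒦.homotopy_of_not_rel _ a (not_exists.1 hb)
  have hzero : (fun a => g a a) = 0 := by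
    refine 𝒦.eq_zero_of_eq_sum_strip _ fun b => ?_
    have := haux g hmem hdiag b
    rwa [hhom, map_zero, map_zero, add_zero, sub_zero] at this
  refine (sub_eq_zero.1 ?_).symm
  ext a b
  by_cases hab : a = b
  · subst hab
    exact congrFun hzero a
  · exact koszul_eq_zero hmem hab

theorem exact_koszulD₀ : Function.Exact (𝒦.koszulD T 0) (𝒦.koszulD₀ T) := by
  intro f
  constructor
  · intro h
    refine ⟨⟨𝒦.homotopy f, 𝒦.homotopy_mem f.2⟩, Subtype.ext ?_⟩
    rw [coe_koszulD, pow_zero, one_smul]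
    exact 𝒦.eq_dLeft_add_dRight_homotopy f.2 (congrArg Subtype.val h)
  · rintro ⟨g, rfl⟩
    refine Subtype.ext ?_
    rw [coe_koszulD₀, coe_koszulD, pow_zero, one_smul]
    exact 𝒦.diagMap_dLeft_add_dRight _

end Augmentation

section Resolution

/-- The Koszul resolution of a module. -/
noncomputable def projRes (X : ModuleCat.{u} B) [Module k X] [IsScalarTower k B X] :
    ProjRes X where
  K
    | 0 => ModuleCat.of B (𝒦.koszulZero X)
    | n + 1 => ModuleCat.of B (𝒦.koszul X n)
  proj
    | 0 => 𝒦.projective_koszulZero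
    | n + 1 => 𝒦.projective_koszul n
  d
    | 0 => 𝒦.koszulD₀ X
    | n + 1 => 𝒦.koszulD X n
  aug := 𝒦.koszulAug X
  aug_surj := 𝒦.koszulAug_surjective
  exact_aug := 𝒦.exact_koszulAug
  exact
    | 0 => 𝒦.exact_koszulD₀
    | n + 1 => 𝒦.exact_koszulD n

end Resolution

end KoszulData

namespace KoszulData

open TensorProduct
open scoped Classical

variable {k B T : Type u} [Field k] [Ring B] [Algebra k B] [AddCommGroup T] [Module k T]
  {Q : GentleQuiverData.{u}} (𝒦 : KoszulData Q k B)

section Periodicity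

/-- Restriction of a family to the cyclic arrows. -/
noncomputable def cyclicPart (Q : GentleQuiverData.{u}) (k B T : Type u) [Field k] [Ring B]
    [Algebra k B] [AddCommGroup T] [Module k T] :
    (Q.E → Q.E → B ⊗[k] T) →ₗ[B] (Q.E → Q.E → B ⊗[k] T) :=
  LinearMap.pi fun a => if Q.Cyclic a then LinearMap.proj a else 0

theorem cyclicPart_apply (f : Q.E → Q.E → B ⊗[k] T) (a b : Q.E) :
    cyclicPart Q k B T f a b = if Q.Cyclic a then f a b else 0 := by
  simp only [cyclicPart, LinearMap.pi_apply]
  split_ifs <;> rfl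

/-- The lowest component of the periodicity map: the sum of all cyclic components. -/
noncomputable def cyclicSum (Q : GentleQuiverData.{u}) (k B T : Type u) [Field k] [Ring B]
    [Algebra k B] [AddCommGroup T] [Module k T] : (Q.E → Q.E → B ⊗[k] T) →ₗ[B] B ⊗[k] T :=
  (∑ a, ∑ b, LinearMap.proj b ∘ₗ LinearMap.proj a) ∘ₗ cyclicPart Q k B T

theorem cyclicSum_apply (f : Q.E → Q.E → B ⊗[k] T) :
    cyclicSum Q k B T f = ∑ a, ∑ b, cyclicPart Q k B T f a b := by
  simp [cyclicSum]

theorem cyclicPart_dRight (f : Q.E → Q.E → B ⊗[k] T) :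
    𝒦.dRight (cyclicPart Q k B T f) = cyclicPart Q k B T (𝒦.dRight f) := by
  ext a b
  simp only [cyclicPart_apply, dRight_apply]
  split_ifs <;> simp

variable [Module B T] [IsScalarTower k B T]

theorem cyclicPart_dLeft (f : Q.E → Q.E → B ⊗[k] T) :
    𝒦.dLeft (cyclicPart Q k B T f) = cyclicPart Q k B T (𝒦.dLeft f) := by
  ext a b
  by_cases h : ∃ c, Q.rel c a
  · obtain ⟨c, hc⟩ := h
    rw [𝒦.dLeft_of_rel _ hc, cyclicPart_apply, cyclicPart_apply, 𝒦.dLeft_of_rel _ hc,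
      GentleQuiverData.cyclic_iff_of_rel hc]
    split_ifs <;> simp
  · rw [cyclicPart_apply, 𝒦.dLeft_of_not_rel _ (not_exists.1 h),
      𝒦.dLeft_of_not_rel _ (not_exists.1 h), ite_self]

theorem cyclicPart_mem {m n : ℕ} (hm : ∀ a, Q.Cyclic a → Q.Chain m a a)
    {f : Q.E → Q.E → B ⊗[k] T} (hf : f ∈ 𝒦.koszul T (m + n)) :
    cyclicPart Q k B T f ∈ 𝒦.koszul T n := by
  intro a b
  rw [cyclicPart_apply]
  split_ifs with h
  · refine ⟨koszul_rmul hf a b, koszul_act hf a b, fun h' => koszul_eq_zero hf fun h'' => h' ?_⟩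
    exact (GentleQuiverData.Chain.add_iff (hm a h)).1 h''
  · simp

theorem cyclicPart_eq_self {n : ℕ} (hn : ∀ a b, Q.Chain n a b → Q.Cyclic a)
    {f : Q.E → Q.E → B ⊗[k] T} (hf : f ∈ 𝒦.koszul T n) : cyclicPart Q k B T f = f := by
  ext a b
  rw [cyclicPart_apply]
  split_ifs with h
  · rfl
  · exact (koszul_eq_zero hf fun h' => h (hn a b h')).symm

theorem mem_koszul_add {m n : ℕ} (hm : ∀ a, Q.Cyclic a → Q.Chain m a a)
    (hn : ∀ a b, Q.Chain n a b → Q.Cyclic a) {f : Q.E → Q.E → B ⊗[k] T}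
    (hf : f ∈ 𝒦.koszul T n) : f ∈ 𝒦.koszul T (m + n) :=
  fun a b => ⟨koszul_rmul hf a b, koszul_act hf a b, fun h => koszul_eq_zero hf fun h' =>
    h ((hm a (hn a b h')).add h')⟩

theorem cyclicSum_mem {m : ℕ} (hm : ∀ a, Q.Cyclic a → Q.Chain (m + 1) a a)
    {f : Q.E → Q.E → B ⊗[k] T} (hf : f ∈ 𝒦.koszul T m) :
    cyclicSum Q k B T f ∈ 𝒦.koszulZero T := by
  rw [cyclicSum_apply]
  refine sum_mem fun a _ => sum_mem fun b _ => ?_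
  rw [cyclicPart_apply]
  split_ifs with h
  · by_cases hab : Q.Chain m a b
    · obtain ⟨c, hc, hr⟩ := hm a h
      obtain rfl := hab.right_unique hc
      refine 𝒦.vertexProj_eq_self (koszul_rmul hf a b) ?_
      rw [Q.rel_comp _ _ hr]
      exact koszul_act hf a b
    · rw [koszul_eq_zero hf hab]
      exact zero_mem _
  · exact zero_mem _

theorem diagMap_cyclicPart {m : ℕ} (hm : ∀ a, Q.Cyclic a → Q.Chain (m + 1) a a)
    {f : Q.E → Q.E → B ⊗[k] T} (hf : f ∈ 𝒦.koszul T (m + 1)) :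
    𝒦.diagMap (cyclicPart Q k B T f) = cyclicSum Q k B T (𝒦.dLeft f - 𝒦.dRight f) := by
  have hdiag : ∀ a b, a ≠ b → cyclicPart Q k B T f a b = 0 := by
    intro a b hab
    rw [cyclicPart_apply]
    split_ifs with h
    · exact koszul_eq_zero hf fun h' => hab ((hm a h).right_unique h')
    · rfl
  rw [cyclicSum_apply, map_sub, ← cyclicPart_dLeft, ← cyclicPart_dRight, diagMap_apply]
  simp only [Pi.sub_apply]
  simp only [Finset.sum_sub_distrib]
  congr 1
  · rw [Finset.sum_comm]
    refine Finset.sum_congr rfl fun b _ => ?_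
    simp only [dLeft_apply]
    rw [Finset.sum_comm, Finset.sum_eq_single b]
    · by_cases h : Q.Cyclic b
      · obtain ⟨c, hc, -⟩ := (hm b h).exists_rel
        rw [Finset.sum_eq_single c, if_pos hc]
        · exact fun d _ hd => if_neg fun h' => hd (Q.rel_right_unique _ _ _ h' hc)
        · simp
      · simp [cyclicPart_apply, h]
    · intro a _ hab
      simp [hdiag a b hab]
    · simp
  · refine Finset.sum_congr rfl fun a _ => ?_
    simp only [dRight_apply]
    rw [Finset.sum_comm, Finset.sum_eq_single a]
    · by_cases h : Q.Cyclic a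
      · obtain ⟨c, -, hc⟩ := hm a h
        rw [Finset.sum_eq_single c, if_pos hc]
        · exact fun d _ hd => if_neg fun h' => hd (Q.rel_left_unique _ _ _ h' hc)
        · simp
      · simp [cyclicPart_apply, h]
    · intro b _ hab
      simp [hdiag a b (Ne.symm hab)]
    · simp

/-- The periodicity map on the Koszul resolution. -/
noncomputable def periodicity (X : ModuleCat.{u} B) [Module k X] [IsScalarTower k B X] {m : ℕ}
    (hm : ∀ a, Q.Cyclic a → Q.Chain (m + 1) a a) :
    ∀ n, (𝒦.projRes X).K (m + n + 1) →ₗ[B] (𝒦.projRes X).K n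
  | 0 => (cyclicSum Q k B X).restrict fun _ hf => 𝒦.cyclicSum_mem hm hf
  | n + 1 => (cyclicPart Q k B X).restrict (p := 𝒦.koszul X (m + (n + 1)))
      (q := 𝒦.koszul X n) fun f hf => 𝒦.cyclicPart_mem hm
        (show f ∈ 𝒦.koszul X (m + 1 + n) by rwa [add_right_comm, add_assoc])

theorem d_periodicity (X : ModuleCat.{u} B) [Module k X] [IsScalarTower k B X] {m : ℕ}
    (hm : ∀ a, Q.Cyclic a → Q.Chain (m + 1) a a) (hodd : Odd m) (n : ℕ)
    (f : (𝒦.projRes X).K (m + (n + 1) + 1)) :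
    (𝒦.projRes X).d n (𝒦.periodicity X hm (n + 1) f) =
      𝒦.periodicity X hm n ((𝒦.projRes X).d (m + n + 1) f) := by
  cases n with
  | zero =>
    refine Subtype.ext ?_
    obtain ⟨f, hf⟩ := f
    refine (𝒦.diagMap_cyclicPart hm hf).trans (congrArg (cyclicSum Q k B X) ?_)
    change _ = 𝒦.dLeft f + (-1 : ℤˣ) ^ m • 𝒦.dRight f
    rw [hodd.neg_one_pow, Units.neg_smul, one_smul, sub_eq_add_neg]
  | succ n =>
    refine Subtype.ext ?_
    obtain ⟨f, hf⟩ := f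
    change 𝒦.dLeft (cyclicPart Q k B X f) + (-1 : ℤˣ) ^ n • 𝒦.dRight (cyclicPart Q k B X f) =
      cyclicPart Q k B X (𝒦.dLeft f + (-1 : ℤˣ) ^ (m + (n + 1)) • 𝒦.dRight f)
    rw [pow_add, pow_succ, hodd.neg_one_pow, mul_neg_one, neg_mul_neg, one_mul, map_add,
      Units.smul_def, Units.smul_def, map_zsmul, cyclicPart_dLeft, cyclicPart_dRight]

theorem bijective_periodicity (X : ModuleCat.{u} B) [Module k X] [IsScalarTower k B X] {m : ℕ}
    (hm : ∀ a, Q.Cyclic a → Q.Chain (m + 1) a a) {n : ℕ}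
    (hn : ∀ l, n ≤ l → ∀ a b, Q.Chain l a b → Q.Cyclic a) :
    Function.Bijective (𝒦.periodicity X hm (n + 1)) := by
  have hmn : m + (n + 1) = m + 1 + n := by rw [add_right_comm, add_assoc]
  constructor
  · rintro ⟨f, hf⟩ ⟨g, hg⟩ h
    have h : cyclicPart Q k B X f = cyclicPart Q k B X g := congrArg Subtype.val h
    refine Subtype.ext ?_
    rwa [𝒦.cyclicPart_eq_self (hn _ (by omega)) hf,
      𝒦.cyclicPart_eq_self (hn _ (by omega)) hg] at h
  · rintro ⟨f, hf⟩
    refine ⟨⟨f, ?_⟩, Subtype.ext (𝒦.cyclicPart_eq_self (hn n le_rfl) hf)⟩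
    change f ∈ 𝒦.koszul X (m + (n + 1))
    rw [hmn]
    exact 𝒦.mem_koszul_add hm (hn n le_rfl) hf

/-- A module with vanishing positive self-extensions over an algebra with Koszul data has
finite projective dimension. -/
theorem hasFiniteProjDim [HasExt.{w} (ModuleCat.{u} B)] (𝒦 : KoszulData Q k B)
    (X : ModuleCat.{u} B) [Module k X] [IsScalarTower k B X] (h : ∀ i, 0 < i → Subsingleton (Abelian.Ext X X i)) :
    HasFiniteProjDim X := by
  obtain ⟨N, hN, hchain⟩ := Q.exists_chain_self_of_cyclic
  obtain ⟨n, hn⟩ := Q.exists_forall_chain_cyclic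
  have hm : ∀ a, Q.Cyclic a → Q.Chain (N + N - 1 + 1) a a := fun a ha => by
    rw [Nat.sub_add_cancel (by omega)]
    exact (hchain a ha).add (hchain a ha)
  refine (𝒦.projRes X).hasFiniteProjDim_of_periodic (N + N - 1) (h _ (Nat.succ_pos _))
    (𝒦.periodicity X hm) (𝒦.d_periodicity X hm ⟨N - 1, by omega⟩) (n + 1) fun l hl => ?_
  obtain ⟨l, rfl⟩ : ∃ j, l = j + 1 := ⟨l - 1, by omega⟩
  exact 𝒦.bijective_periodicity X hm fun j hj => hn j (by omega)

end Periodicity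

end KoszulData

section GentleKoszulData

open MulOpposite
open scoped Classical

variable (Q : GentleQuiverData.{u})

namespace GentleAlg

/-- The image of a vertex in the gentle algebra. -/
noncomputable def vertex (v : Q.V) : GentleAlg k Q :=
  RingQuot.mkAlgHom k (GentleRel k Q) (FreeAlgebra.ι k (Sum.inl v))

/-- The image of an arrow in the gentle algebra. -/
noncomputable def arrow (a : Q.E) : GentleAlg k Q :=
  RingQuot.mkAlgHom k (GentleRel k Q) (FreeAlgebra.ι k (Sum.inr a))

theorem vertex_mul_vertex (v w : Q.V) :
    vertex k Q v * vertex k Q w = if v = w then vertex k Q v else 0 := by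
  split_ifs with h
  · subst h
    simpa [vertex] using RingQuot.mkAlgHom_rel k (GentleRel.idem (k := k) v)
  · simpa [vertex] using RingQuot.mkAlgHom_rel k (GentleRel.orth (k := k) v w h)

theorem sum_vertex : ∑ v, vertex k Q v = 1 := by
  simpa [vertex] using RingQuot.mkAlgHom_rel k (GentleRel.sum_idem (k := k) (Q := Q))

theorem vertex_mul_arrow (a : Q.E) :
    vertex k Q (Q.src a) * arrow k Q a = arrow k Q a := by
  simpa [vertex, arrow] using RingQuot.mkAlgHom_rel k (GentleRel.src_mul (k := k) a)

theorem arrow_mul_vertex (a : Q.E) :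
    arrow k Q a * vertex k Q (Q.tgt a) = arrow k Q a := by
  simpa [vertex, arrow] using RingQuot.mkAlgHom_rel k (GentleRel.mul_tgt (k := k) a)

theorem arrow_mul_arrow (a b : Q.E) (h : Q.rel a b) : arrow k Q a * arrow k Q b = 0 := by
  simpa [arrow] using RingQuot.mkAlgHom_rel k (GentleRel.relation (k := k) a b h)

/-- The action of a vertex in the representation defining the stripping operators. -/
noncomputable def vertexEnd (v : Q.V) :
    Module.End k (GentleAlg k Q × (Q.E → GentleAlg k Q)) where
  toFun p := (vertex k Q v * p.1, fun b => if v = Q.src b then p.2 b else 0)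
  map_add' p q := by
    ext b
    · simp [mul_add]
    · simp only [Prod.snd_add, Pi.add_apply]
      split_ifs <;> simp
  map_smul' r p := by
    ext b
    · simp
    · simp only [Prod.smul_snd, Pi.smul_apply, RingHom.id_apply]
      split_ifs <;> simp

/-- The action of an arrow in the representation defining the stripping operators. -/
noncomputable def arrowEnd (a : Q.E) :
    Module.End k (GentleAlg k Q × (Q.E → GentleAlg k Q)) where
  toFun p := (arrow k Q a * p.1, fun b => if a = b then vertex k Q (Q.tgt a) * p.1 -
    ∑ c, if Q.rel a c then arrow k Q c * p.2 c else 0 else 0)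
  map_add' p q := by
    ext b
    · simp [mul_add]
    · simp only [Prod.snd_add, Prod.fst_add, Pi.add_apply]
      split_ifs
      · rw [mul_add, ← add_sub_add_comm, ← Finset.sum_add_distrib]
        congr 2 with c
        split_ifs <;> simp [mul_add]
      · simp
  map_smul' r p := by
    ext b
    · simp
    · simp only [Prod.smul_snd, Prod.smul_fst, Pi.smul_apply, RingHom.id_apply]
      split_ifs
      · rw [smul_sub, Finset.smul_sum, mul_smul_comm]
        congr 2 with c
        split_ifs <;> simp
      · simp

theorem arrowEnd_of_rel {a b : Q.E} (h : Q.rel a b)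
    (p : GentleAlg k Q × (Q.E → GentleAlg k Q)) :
    arrowEnd k Q a p = (arrow k Q a * p.1, fun c => if a = c then
      vertex k Q (Q.tgt a) * p.1 - arrow k Q b * p.2 b else 0) := by
  have : ∑ c, (if Q.rel a c then arrow k Q c * p.2 c else 0) = arrow k Q b * p.2 b := by
    rw [Finset.sum_eq_single b, if_pos h]
    · exact fun d _ hd => if_neg fun h' => hd (Q.rel_right_unique _ _ _ h' h)
    · simp
  simp [arrowEnd, this]

/-- The representation of the gentle algebra defining the stripping operators. -/
noncomputable def stripRep :
    GentleAlg k Q →ₐ[k] Module.End k (GentleAlg k Q × (Q.E → GentleAlg k Q)) :=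
  RingQuot.liftAlgHom k ⟨FreeAlgebra.lift k (Sum.elim (vertexEnd k Q) (arrowEnd k Q)), by
    intro y z h
    cases h with
    | idem v =>
      simp only [map_mul, FreeAlgebra.lift_ι_apply, Sum.elim_inl]
      refine LinearMap.ext fun p => Prod.ext ?_ (funext fun b => ?_)
      · simp [vertexEnd, ← mul_assoc, vertex_mul_vertex]
      · simp only [vertexEnd, Module.End.mul_apply, LinearMap.coe_mk, AddHom.coe_mk]
        split_ifs <;> rfl
    | orth v w hvw =>
      simp only [map_mul, map_zero, FreeAlgebra.lift_ι_apply, Sum.elim_inl]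
      refine LinearMap.ext fun p => Prod.ext ?_ (funext fun b => ?_)
      · simp [vertexEnd, ← mul_assoc, vertex_mul_vertex, hvw]
      · simp only [vertexEnd, Module.End.mul_apply, LinearMap.coe_mk, AddHom.coe_mk]
        split_ifs with h₁ h₂
        · exact absurd (h₁.trans h₂.symm) hvw
        · rfl
        · rfl
    | sum_idem =>
      simp only [map_sum, map_one, FreeAlgebra.lift_ι_apply, Sum.elim_inl]
      refine LinearMap.ext fun p => Prod.ext ?_ (funext fun b => ?_)
      · simp [vertexEnd, Prod.fst_sum, ← Finset.sum_mul, sum_vertex]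
      · simp [vertexEnd, Prod.snd_sum]
    | src_mul a =>
      simp only [map_mul, FreeAlgebra.lift_ι_apply, Sum.elim_inl, Sum.elim_inr]
      refine LinearMap.ext fun p => Prod.ext ?_ (funext fun b => ?_)
      · simp [vertexEnd, arrowEnd, ← mul_assoc, vertex_mul_arrow]
      · simp only [vertexEnd, arrowEnd, Module.End.mul_apply, LinearMap.coe_mk, AddHom.coe_mk]
        by_cases hab : a = b
        · simp [hab]
        · simp [hab]
    | mul_tgt a =>
      simp only [map_mul, FreeAlgebra.lift_ι_apply, Sum.elim_inl, Sum.elim_inr]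
      refine LinearMap.ext fun p => Prod.ext ?_ (funext fun b => ?_)
      · simp [vertexEnd, arrowEnd, ← mul_assoc, arrow_mul_vertex]
      · simp only [vertexEnd, arrowEnd, Module.End.mul_apply, LinearMap.coe_mk, AddHom.coe_mk]
        split_ifs
        · rw [← mul_assoc, vertex_mul_vertex, if_pos rfl]
          congr 2 with c
          split_ifs with hr h'
          · rfl
          · exact absurd (Q.rel_comp _ _ hr) h'
          · rfl
        · rfl
    | relation a b h =>
      simp only [map_mul, map_zero, FreeAlgebra.lift_ι_apply, Sum.elim_inr]
      refine LinearMap.ext fun p => ?_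
      rw [Module.End.mul_apply, arrowEnd_of_rel k Q h]
      refine Prod.ext ?_ (funext fun c => ?_)
      · simp [arrowEnd, ← mul_assoc, arrow_mul_arrow k Q a b h]
      · have hz : ∀ c, Q.rel b c → arrow k Q b * (arrow k Q c * p.2 c) = 0 := fun c hc => by
          rw [← mul_assoc, arrow_mul_arrow k Q b c hc, zero_mul]
        simp only [arrowEnd, LinearMap.coe_mk, AddHom.coe_mk, if_true, LinearMap.zero_apply]
        split_ifs
        · rw [mul_sub, ← mul_assoc (arrow k Q b), arrow_mul_vertex, ← mul_assoc,
            Q.rel_comp _ _ h, vertex_mul_arrow, Finset.mul_sum, Finset.sum_eq_zero]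
          · simp
          · intro c _
            split_ifs with hc
            · exact hz c hc
            · exact mul_zero _
        · rfl⟩

theorem stripRep_vertex (v : Q.V) : stripRep k Q (vertex k Q v) = vertexEnd k Q v := by
  simp [stripRep, vertex]

theorem stripRep_arrow (a : Q.E) : stripRep k Q (arrow k Q a) = arrowEnd k Q a := by
  simp [stripRep, arrow]

/-- Induction principle: the gentle algebra is spanned by products of generators. -/
theorem induction_mul {P : GentleAlg k Q → Prop} (one : P 1)
    (add : ∀ y z, P y → P z → P (y + z)) (smul : ∀ (r : k) y, P y → P (r • y))
    (vertex_mul : ∀ y v, P y → P (vertex k Q v * y))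
    (arrow_mul : ∀ y a, P y → P (arrow k Q a * y)) (y : GentleAlg k Q) : P y := by
  suffices h : ∀ y z, P z → P (y * z) by simpa using h y 1 one
  intro y
  obtain ⟨y, rfl⟩ := RingQuot.mkAlgHom_surjective k (GentleRel k Q) y
  induction y with
  | grade0 r =>
    intro z hz
    rw [AlgHom.commutes, ← Algebra.smul_def]
    exact smul r z hz
  | grade1 i =>
    intro z hz
    cases i with
    | inl v => exact vertex_mul z v hz
    | inr a => exact arrow_mul z a hz
  | mul y y' hy hy' =>
    intro z hz
    rw [map_mul, mul_assoc]
    exact hy _ (hy' z hz)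
  | add y y' hy hy' =>
    intro z hz
    rw [map_add, add_mul]
    exact add _ _ (hy z hz) (hy' z hz)

theorem fst_stripRep (y : GentleAlg k Q) : (stripRep k Q y (1, 0)).1 = y := by
  induction y using induction_mul with
  | one => simp
  | add y z hy hz => simp [hy, hz]
  | smul r y hy => simp [hy]
  | vertex_mul y v hy =>
    rw [map_mul, stripRep_vertex]
    exact congrArg (vertex k Q v * ·) hy
  | arrow_mul y a hy =>
    rw [map_mul, stripRep_arrow]
    exact congrArg (arrow k Q a * ·) hy

/-- The stripping operators on the gentle algebra. -/
noncomputable def strip (b : Q.E) : GentleAlg k Q →ₗ[k] GentleAlg k Q :=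
  LinearMap.proj b ∘ₗ LinearMap.snd k _ _ ∘ₗ LinearMap.applyₗ (1, 0) ∘ₗ
    (stripRep k Q).toLinearMap

theorem strip_apply (b : Q.E) (y : GentleAlg k Q) :
    strip k Q b y = (stripRep k Q y (1, 0)).2 b := rfl

theorem strip_vertex_mul (b : Q.E) (v : Q.V) (y : GentleAlg k Q) :
    strip k Q b (vertex k Q v * y) = if v = Q.src b then strip k Q b y else 0 := by
  rw [strip_apply, map_mul, stripRep_vertex]
  rfl

theorem strip_arrow_mul (b a : Q.E) (y : GentleAlg k Q) :
    strip k Q b (arrow k Q a * y) = if a = b then vertex k Q (Q.tgt a) * y -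
      ∑ c, if Q.rel a c then arrow k Q c * strip k Q c y else 0 else 0 := by
  rw [strip_apply, map_mul, stripRep_arrow]
  simp only [Module.End.mul_apply, arrowEnd, LinearMap.coe_mk, AddHom.coe_mk, fst_stripRep,
    strip_apply]

/-- The Koszul data on the opposite of a gentle algebra. -/
noncomputable def koszulData : KoszulData Q k (GentleAlg k Q)ᵐᵒᵖ where
  e v := op (vertex k Q v)
  x a := op (arrow k Q a)
  D b := (opLinearEquiv k).toLinearMap ∘ₗ strip k Q b ∘ₗ (opLinearEquiv k).symm.toLinearMap
  e_mul_e_self v := by rw [← op_mul, vertex_mul_vertex, if_pos rfl]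
  e_mul_e_of_ne v w h := by rw [← op_mul, vertex_mul_vertex, if_neg (Ne.symm h), op_zero]
  sum_e := by rw [← Finset.op_sum, sum_vertex, op_one]
  x_mul_e a := by rw [← op_mul, vertex_mul_arrow]
  e_mul_x a := by rw [← op_mul, arrow_mul_vertex]
  x_mul_x a b h := by rw [← op_mul, arrow_mul_arrow k Q a b h, op_zero]
  D_one b := by
    change op ((stripRep k Q 1 (1, 0)).2 b) = 0
    simp
  D_mul_e b y v := by
    refine (congrArg op (strip_vertex_mul k Q b v (unop y))).trans ?_
    split_ifs <;> rfl
  D_mul_x b y a := by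
    refine (congrArg op (strip_arrow_mul k Q b a (unop y))).trans ?_
    split_ifs
    · rw [MulOpposite.op_sub, Finset.op_sum]
      congr 2 with c
      split_ifs <;> rfl
    · rfl
  induction P one add smul mul_e mul_x y :=
    induction_mul k Q (P := fun y => P (op y)) one (fun _ _ => add _ _) (fun r _ => smul r _)
      (fun _ v => mul_e _ v) (fun _ a => mul_x _ a) (unop y)

end GentleAlg

end GentleKoszulData

/-- Every self-orthogonal module over a gentle algebra has finite projective
dimension; in particular it is a pre-tilting module. -/
theorem selforthogonal_finite_projdim
    (k : Type u) [Field k] [IsAlgClosed k]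
    (Q : GentleQuiverData.{u})
    (hfd : FiniteDimensional k (GentleAlg k Q))
    (T : ModuleCat.{u} (GentleAlg k Q)ᵐᵒᵖ)
    (hTfin : Module.Finite (GentleAlg k Q)ᵐᵒᵖ T)
    (hTorth : SelfOrthogonal T) :
    HasFiniteProjDim T ∧ IsPreTilting T := by
  let : Module k T := Module.compHom T (algebraMap k (GentleAlg k Q)ᵐᵒᵖ)
  have : IsScalarTower k (GentleAlg k Q)ᵐᵒᵖ T := IsScalarTower.of_compHom _ _ _
  let : HasDerivedCategory.{u + 1} (ModuleCat.{u} (GentleAlg k Q)ᵐᵒᵖ) :=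
    HasDerivedCategory.standard _
  let : HasExt.{u + 1} (ModuleCat.{u} (GentleAlg k Q)ᵐᵒᵖ) := hasExt_of_hasDerivedCategory _
  have h := (GentleAlg.koszulData k Q).hasFiniteProjDim T hTorth
  exact ⟨h, h, hTorth⟩
end
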